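/- Let M = M^0(S; F(I), G(Lambda); P) be a finitely generated Rees matrix semigroup with zero over a small category S. If S is prefix-automatic (as a semigroupoid), and the set of non-identity arrows of S is strongly right-ideal-generated by a row cross-section of P, then M is a prefix-automatic semigroup. -/

import Mathlib

/- Common framework: graphs, path languages, synchronous regularity,
   semigroupoids, automatic structures, and Rees matrix constructions. -/

namespace AutoRees

/-- Raw data of a semigroupoid: source and target maps on arrows together with a
totalised multiplication (whose values are only meaningful on composable pairs). -/
structure PreSgpd (O A : Type) where
  src : A → O
  tgt : A → O
  mul : A → A → A

/-- A semigroupoid: the multiplication respects sources and targets and is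
associative, on composable pairs. -/
structure Sgpd (O A : Type) extends PreSgpd O A where
  src_mul : ∀ e f, tgt e = src f → src (mul e f) = src e
  tgt_mul : ∀ e f, tgt e = src f → tgt (mul e f) = tgt f
  mul_assoc' : ∀ e f g, tgt e = src f → tgt f = src g →
    mul (mul e f) g = mul e (mul f g)

/-- Evaluate a nonempty word of edge labels as a product in the semigroupoid
(`none` on the empty word). -/
def evalPath? {O A E : Type} (S : PreSgpd O A) (lab : E → A) : List E → Option A
  | [] => none
  | e :: l => some ((l.map lab).foldl S.mul (lab e))

/-- The consecutive-compatibility condition making a list of edges a path. -/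
def IsPathChain {V E : Type} (esrc etgt : E → V) (l : List E) : Prop :=
  List.Chain' (fun e f => etgt e = esrc f) l

/-- The target of a non-empty path. -/
def pathTgt? {V E : Type} (etgt : E → V) (l : List E) : Option V :=
  l.getLast?.map etgt

/-- The source of a non-empty path. -/
def pathSrc? {V E : Type} (esrc : E → V) (l : List E) : Option V :=
  l.head?.map esrc

/-- A set of words is regular if it is a regular language in the usual sense. -/
def IsRegularSet {α : Type} (L : Set (List α)) : Prop :=
  Language.IsRegular (show Language α from L)

/-- The padding symbol used to pad a pair of paths, at the target of `l`
(the letters of the padded alphabet `X^$` are `Sum.inl` (a genuine edge) or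
`Sum.inr (some v)` (the padding edge at vertex `v`)). -/
def padSym {V E : Type} (etgt : E → V) (l : List E) : E ⊕ Option V :=
  Sum.inr (l.getLast?.map etgt)

/-- The padded convolution `(a, b) δ_X` of a pair of paths. -/
def deltaPair {V E : Type} (etgt : E → V) (a b : List E) :
    List ((E ⊕ Option V) × (E ⊕ Option V)) :=
  (a.map Sum.inl).zip (b.map Sum.inl) ++
    (if a.length ≤ b.length
      then (b.drop a.length).map (fun e => (padSym etgt a, Sum.inl e))
      else (a.drop b.length).map (fun e => (Sum.inl e, padSym etgt b)))

/-- A binary relation on paths is synchronously regular if its image under the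
padding map is a regular language over the padded product alphabet. -/
def SyncRegular {V E : Type} (etgt : E → V) (R : Set (List E × List E)) : Prop :=
  IsRegularSet { w | ∃ p ∈ R, w = deltaPair etgt p.1 p.2 }

/-- A choice of representatives `(X, K, ρ)` for a semigroupoid `S`: a graph `X`
with vertex set `S^0` (edge set `E`, source `esrc`, target `etgt`), a semigroupoid
morphism `ρ : X^+ → S` (induced by the edge-labelling `lab`), and a language `K`
of non-empty paths with `K ρ = S^1`. -/
structure ChoiceOfReps {O A : Type} (S : PreSgpd O A) (E : Type) where
  esrc : E → O
  etgt : E → O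
  lab : E → A
  lab_src : ∀ e, S.src (lab e) = esrc e
  lab_tgt : ∀ e, S.tgt (lab e) = etgt e
  K : Set (List E)
  K_path : ∀ l ∈ K, l ≠ [] ∧ IsPathChain esrc etgt l
  K_onto : ∀ a : A, ∃ l ∈ K, evalPath? S lab l = some a

variable {O A E : Type} {S : PreSgpd O A}

/-- The relation `K_=` = {(u,v) ∈ K × K : u ρ = v ρ}. -/
def relEq (C : ChoiceOfReps S E) : Set (List E × List E) :=
  { p | p.1 ∈ C.K ∧ p.2 ∈ C.K ∧ evalPath? S C.lab p.1 = evalPath? S C.lab p.2 }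

/-- The relation `K_a` for an edge `a` of `X`. -/
def relEdge (C : ChoiceOfReps S E) (a : E) : Set (List E × List E) :=
  { p | p.1 ∈ C.K ∧ p.2 ∈ C.K ∧ pathTgt? C.etgt p.1 = some (C.esrc a) ∧
        evalPath? S C.lab (p.1 ++ [a]) = evalPath? S C.lab p.2 }

/-- The relation `K_a` for a vertex `a` of `X` (regarded as the empty path at `a`). -/
def relVertex (C : ChoiceOfReps S E) (v : O) : Set (List E × List E) :=
  { p | p.1 ∈ C.K ∧ p.2 ∈ C.K ∧ pathTgt? C.etgt p.1 = some v ∧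
        evalPath? S C.lab p.1 = evalPath? S C.lab p.2 }

/-- An automatic structure: a finitely generated choice of representatives with
`K` regular such that `K_a` is synchronously regular for every edge and vertex. -/
def IsAutomaticStructure (C : ChoiceOfReps S E) : Prop :=
  Finite E ∧ IsRegularSet C.K ∧
    (∀ a : E, SyncRegular C.etgt (relEdge C a)) ∧
    (∀ v : O, SyncRegular C.etgt (relVertex C v))

/-- The set of non-empty prefixes of words in `K`. -/
def prefs {E : Type} (K : Set (List E)) : Set (List E) :=
  { p | p ≠ [] ∧ ∃ l ∈ K, p <+: l }

/-- The relation `K'_=` = {(u,v) ∈ K × Pref(K) : u ρ = v ρ}. -/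
def relPrefEq (C : ChoiceOfReps S E) : Set (List E × List E) :=
  { p | p.1 ∈ C.K ∧ p.2 ∈ prefs C.K ∧ evalPath? S C.lab p.1 = evalPath? S C.lab p.2 }

/-- A prefix-automatic structure. -/
def IsPrefixAutomaticStructure (C : ChoiceOfReps S E) : Prop :=
  IsAutomaticStructure C ∧ SyncRegular C.etgt (relPrefEq C)

/-- A cross-section: `ρ` restricted to `K` is injective. -/
def IsCrossSection (C : ChoiceOfReps S E) : Prop :=
  ∀ u ∈ C.K, ∀ v ∈ C.K, evalPath? S C.lab u = evalPath? S C.lab v → u = v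

/-- `K` is closed under taking non-empty prefixes. -/
def IsPrefixClosed (C : ChoiceOfReps S E) : Prop :=
  ∀ l ∈ C.K, ∀ p : List E, p ≠ [] → p <+: l → p ∈ C.K

/-- A semigroupoid (or semigroup, in the one-object case) is automatic if it
admits an automatic structure. -/
def IsAutomatic (S : PreSgpd O A) : Prop :=
  ∃ (E : Type) (C : ChoiceOfReps S E), IsAutomaticStructure C

/-- Prefix-automaticity. -/
def IsPrefixAutomatic (S : PreSgpd O A) : Prop :=
  ∃ (E : Type) (C : ChoiceOfReps S E), IsPrefixAutomaticStructure C

/-- Finite generation: every arrow is a (composable) product of arrows from some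
fixed finite set. -/
def IsFG (S : PreSgpd O A) : Prop :=
  ∃ T : Set A, T.Finite ∧ ∀ a : A, ∃ l : List A, l ≠ [] ∧ (∀ x ∈ l, x ∈ T) ∧
    IsPathChain S.src S.tgt l ∧ evalPath? S id l = some a

/-- An arrow is an identity if it acts as an identity on all composable products. -/
def IsIdentity (S : PreSgpd O A) (e : A) : Prop :=
  (∀ x, S.tgt e = S.src x → S.mul e x = x) ∧ (∀ y, S.tgt y = S.src e → S.mul y e = y)

/-- A small category is a semigroupoid with an identity arrow at every object. -/
def IsSmallCategory (S : PreSgpd O A) : Prop :=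
  ∀ v : O, ∃ e : A, S.src e = v ∧ S.tgt e = v ∧ IsIdentity S e

/-- No object is isolated. -/
def IsolationFree (S : PreSgpd O A) : Prop :=
  ∀ v : O, ∃ a : A, S.src a = v ∨ S.tgt a = v

namespace Rees

variable {O A I Λ : Type}

/-- A triple `(i, x, λ)` is valid if `i F = x α` and `x ω = λ G`. -/
def Valid (S : Sgpd O A) (F : I → O) (G : Λ → O) (t : I × A × Λ) : Prop :=
  F t.1 = S.src t.2.1 ∧ S.tgt t.2.1 = G t.2.2

/-- The set of valid Rees triples. -/
def Triples (S : Sgpd O A) (F : I → O) (G : Λ → O) : Type :=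
  { t : I × A × Λ // Valid S F G t }

theorem prod_valid (S : Sgpd O A) {F : I → O} {G : Λ → O}
    {i : I} {x : A} {lam : Λ} {j : I} {y : A} {mu : Λ} {p : A}
    (hx : Valid S F G (i, x, lam)) (hy : Valid S F G (j, y, mu))
    (hps : S.src p = G lam) (hpt : S.tgt p = F j) :
    Valid S F G (i, S.mul (S.mul x p) y, mu) := by
  obtain ⟨hx1, hx2⟩ := hx
  obtain ⟨hy1, hy2⟩ := hy
  have h1 : S.tgt x = S.src p := by rw [hps]; exact hx2
  have h2 : S.tgt p = S.src y := by rw [hpt]; exact hy1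
  have h3 : S.tgt (S.mul x p) = S.src y := by rw [S.tgt_mul x p h1]; exact h2
  constructor
  · show F i = S.src (S.mul (S.mul x p) y)
    rw [S.src_mul _ y h3, S.src_mul x p h1]; exact hx1
  · show S.tgt (S.mul (S.mul x p) y) = G mu
    rw [S.tgt_mul _ y h3]; exact hy2

/-- Data for a Rees matrix construction with zero over a semigroupoid `S`:
indexing functions `F`, `G` surjective onto the sets of sources and of targets
respectively, and a sandwich matrix `P` with entries in `S^1 ∪ {0}`
(`none` representing `0`) compatible with `F` and `G`. -/
structure Data0 (S : Sgpd O A) (I Λ : Type) where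
  F : I → O
  G : Λ → O
  P : Λ → I → Option A
  F_into : ∀ i, ∃ a : A, S.src a = F i
  F_onto : ∀ a : A, ∃ i, F i = S.src a
  G_into : ∀ lam, ∃ a : A, S.tgt a = G lam
  G_onto : ∀ a : A, ∃ lam, G lam = S.tgt a
  P_src : ∀ lam i p, P lam i = some p → S.src p = G lam
  P_tgt : ∀ lam i p, P lam i = some p → S.tgt p = F i

/-- Underlying set of the Rees matrix semigroup with zero (`none` is the zero). -/
def Carrier0 (S : Sgpd O A) (R : Data0 S I Λ) : Type :=
  Option (Triples S R.F R.G)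

/-- Multiplication of the Rees matrix semigroup with zero. -/
def mul0 (S : Sgpd O A) (R : Data0 S I Λ) :
    Carrier0 S R → Carrier0 S R → Carrier0 S R
  | some ⟨(i, x, lam), hx⟩, some ⟨(j, y, mu), hy⟩ =>
    match hp : R.P lam j with
    | some p => some ⟨(i, S.mul (S.mul x p) y, mu),
        prod_valid S hx hy (R.P_src lam j p hp) (R.P_tgt lam j p hp)⟩
    | none => none
  | none, _ => none
  | _, none => none

/-- The Rees matrix semigroup with zero `M^0(S; F(I), G(Λ); P)`, as a
one-object semigroupoid (i.e. a semigroup). -/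
def pre0 (S : Sgpd O A) (R : Data0 S I Λ) : PreSgpd Unit (Carrier0 S R) where
  src _ := ()
  tgt _ := ()
  mul := mul0 S R

/-- Data for a Rees matrix construction without zero (no zero entries in `P`). -/
structure Data (S : Sgpd O A) (I Λ : Type) where
  F : I → O
  G : Λ → O
  P : Λ → I → A
  F_into : ∀ i, ∃ a : A, S.src a = F i
  F_onto : ∀ a : A, ∃ i, F i = S.src a
  G_into : ∀ lam, ∃ a : A, S.tgt a = G lam
  G_onto : ∀ a : A, ∃ lam, G lam = S.tgt a
  P_src : ∀ lam i, S.src (P lam i) = G lam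
  P_tgt : ∀ lam i, S.tgt (P lam i) = F i

/-- Underlying set of the Rees matrix semigroup without zero. -/
def Carrier (S : Sgpd O A) (R : Data S I Λ) : Type :=
  Triples S R.F R.G

/-- Multiplication of the Rees matrix semigroup without zero. -/
def mul (S : Sgpd O A) (R : Data S I Λ) :
    Carrier S R → Carrier S R → Carrier S R
  | ⟨(i, x, lam), hx⟩, ⟨(j, y, mu), hy⟩ =>
    ⟨(i, S.mul (S.mul x (R.P lam j)) y, mu),
      prod_valid S hx hy (R.P_src lam j) (R.P_tgt lam j)⟩

/-- The Rees matrix semigroup without zero `M(S; F(I), G(Λ); P)`, as a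
one-object semigroupoid (i.e. a semigroup). -/
def pre (S : Sgpd O A) (R : Data S I Λ) : PreSgpd Unit (Carrier S R) where
  src _ := ()
  tgt _ := ()
  mul := mul S R

/-- The set `S P' S` of arrows of the form `s p t` with `p` a non-zero entry of `P`. -/
def SPS0 (S : Sgpd O A) (R : Data0 S I Λ) : Set A :=
  { a | ∃ s p t lam i, R.P lam i = some p ∧ S.tgt s = S.src p ∧ S.tgt p = S.src t ∧
        a = S.mul (S.mul s p) t }

/-- The set `S P S` for a matrix without zero entries. -/
def SPS (S : Sgpd O A) (R : Data S I Λ) : Set A :=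
  { a | ∃ s t lam i, S.tgt s = S.src (R.P lam i) ∧ S.tgt (R.P lam i) = S.src t ∧
        a = S.mul (S.mul s (R.P lam i)) t }

/-- The set of targets of arrows of `S` (the codomain of `G`). -/
def tgtSet (S : Sgpd O A) : Set O := { v | ∃ a : A, S.tgt a = v }

/-- `T` is strongly right-ideal-generated by a row cross-section of `P`. -/
def StronglyRIG0 (S : Sgpd O A) (R : Data0 S I Λ) (T : Set A) : Prop :=
  ∃ Λ' : Set Λ, Set.BijOn R.G Λ' (tgtSet S) ∧
    ∀ t ∈ T, ∃ lam ∈ Λ', ∃ i p s, R.P lam i = some p ∧ S.tgt p = S.src s ∧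
      t = S.mul p s

/-- `T` is weakly right-ideal-generated by a row cross-section of `P`. -/
def WeaklyRIG0 (S : Sgpd O A) (R : Data0 S I Λ) (T : Set A) : Prop :=
  ∃ Λ' : Set Λ, Set.BijOn R.G Λ' (tgtSet S) ∧
    ∀ t ∈ T, ∃ lam ∈ Λ', ∃ i p, R.P lam i = some p ∧
      (t = p ∨ ∃ s, S.tgt p = S.src s ∧ t = S.mul p s)

/-- Weak right-ideal generation, for a matrix without zero entries. -/
def WeaklyRIG (S : Sgpd O A) (R : Data S I Λ) (T : Set A) : Prop :=
  ∃ Λ' : Set Λ, Set.BijOn R.G Λ' (tgtSet S) ∧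
    ∀ t ∈ T, ∃ lam ∈ Λ', ∃ i,
      (t = R.P lam i ∨ ∃ s, S.tgt (R.P lam i) = S.src s ∧ t = S.mul (R.P lam i) s)

end Rees


/-! ### Machines recognising relations on words -/

/-- Run a two-tape synchronous machine for `n` steps. -/
def mrun {Q α β : Type} (step : Q → Option α → Option β → Q) (u : List α) (v : List β)
    (s : Q) : ℕ → Q
  | 0 => s
  | n + 1 => step (mrun step u v s n) u[n]? v[n]?

/-- A relation recognised by a finite two-tape synchronous machine. -/
def Mach {α β : Type} (R : Set (List α × List β)) : Prop :=
  ∃ (Q : Type) (_ : Finite Q) (step : Q → Option α → Option β → Q) (s : Q) (acc : Set Q),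
    ∀ u v n, u.length ≤ n → v.length ≤ n → ((u, v) ∈ R ↔ mrun step u v s n ∈ acc)

theorem mrun_congr {Q α β : Type} (step : Q → Option α → Option β → Q) {u u' : List α}
    {v v' : List β} (s : Q) {n : ℕ} (hu : ∀ k < n, u[k]? = u'[k]?)
    (hv : ∀ k < n, v[k]? = v'[k]?) : mrun step u v s n = mrun step u' v' s n := by
  induction n with
  | zero => rfl
  | succ n ih =>
    simp only [mrun]
    rw [ih (fun k hk => hu k (by omega)) (fun k hk => hv k (by omega)), hu n (by omega),
      hv n (by omega)]

theorem mrun_add {Q α β : Type} (step : Q → Option α → Option β → Q) {u u' : List α}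
    {v v' : List β} (s : Q) {n m : ℕ} (hu : ∀ k < m, u[n + k]? = u'[k]?)
    (hv : ∀ k < m, v[n + k]? = v'[k]?) :
    mrun step u v s (n + m) = mrun step u' v' (mrun step u v s n) m := by
  induction m with
  | zero => rfl
  | succ m ih =>
    rw [← Nat.add_assoc]
    simp only [mrun]
    rw [ih (fun k hk => hu k (by omega)) (fun k hk => hv k (by omega)), hu m (by omega),
      hv m (by omega)]

theorem reg_of_map {α Q : Type} [Finite Q] (L : Set (List α)) (f : List α → Q)
    (h1 : ∀ z z' a, f z = f z' → f (z ++ [a]) = f (z' ++ [a]))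
    (h2 : ∀ z z', f z = f z' → z ∈ L → z' ∈ L) : IsRegularSet L := by
  apply Language.IsRegular.of_finite_range_leftQuotient
  have key : ∀ y z z', f z = f z' → f (z ++ y) = f (z' ++ y) := by
    intro y
    induction y with
    | nil => intro z z' h; simpa using h
    | cons a y ih =>
      intro z z' h
      have := ih _ _ (h1 z z' a h)
      simpa using this
  have hq : ∀ z z', f z = f z' →
      Language.leftQuotient (show Language α from L) z
        = Language.leftQuotient (show Language α from L) z' := by
    intro z z' h
    ext y
    exact ⟨fun hy => h2 _ _ (key y _ _ h) hy, fun hy => h2 _ _ (key y _ _ h.symm) hy⟩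
  apply Set.Finite.of_finite_image (f := fun l => {q : Q | ∃ z, f z = q ∧
    Language.leftQuotient (show Language α from L) z = l}) (Set.toFinite _)
  rintro _ ⟨z, rfl⟩ _ ⟨z', rfl⟩ h
  have : f z ∈ {q : Q | ∃ z₁, f z₁ = q ∧ Language.leftQuotient (show Language α from L) z₁ =
    Language.leftQuotient (show Language α from L) z'} := by
    have h0 : f z ∈ {q : Q | ∃ z₁, f z₁ = q ∧ Language.leftQuotient (show Language α from L) z₁ =
      Language.leftQuotient (show Language α from L) z} := ⟨z, rfl, rfl⟩
    simpa only [h] using h0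
  obtain ⟨z₁, h3, h4⟩ := this
  rw [← h4]; exact hq _ _ h3.symm

theorem reg_dfa {α : Type} {L : Set (List α)} (h : IsRegularSet L) :
    ∃ (Q : Type) (_ : Finite Q) (step : Q → α → Q) (s : Q) (acc : Set Q),
      ∀ z, z ∈ L ↔ z.foldl step s ∈ acc := by
  obtain ⟨Q, hQ, D, hD⟩ := h
  refine ⟨Q, inferInstance, D.step, D.start, D.accept, fun z => ?_⟩
  have : z ∈ D.accepts ↔ z ∈ L := by rw [hD]; rfl
  rw [← this]; rfl

theorem reg_prefs {α : Type} {L : Set (List α)} (h : IsRegularSet L) :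
    IsRegularSet (prefs L) := by
  obtain ⟨Q, hQ, step, s, acc, hL⟩ := reg_dfa h
  refine reg_of_map (Q := Q × Prop) _ (fun z => (z.foldl step s, z = [])) ?_ ?_
  · intro z z' a h
    simp only [Prod.mk.injEq] at h
    simp [h.1]
  · rintro z z' h ⟨h1, l, hl, t, rfl⟩
    simp only [Prod.mk.injEq] at h
    refine ⟨fun h3 => h1 (by rw [h.2]; exact h3), z' ++ t, ?_, t, rfl⟩
    rw [hL] at hl ⊢
    rw [List.foldl_append] at hl ⊢
    rwa [← h.1]

theorem Mach.diag {α : Type} {R : Set (List α × List α)} (h : Mach R) :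
    IsRegularSet {u | (u, u) ∈ R} := by
  obtain ⟨Q, hQ, step, s, acc, hR⟩ := h
  refine reg_of_map _ (fun z => mrun step z z s z.length) ?_ ?_
  · have : ∀ (z : List α) a, mrun step (z ++ [a]) (z ++ [a]) s (z ++ [a]).length
        = step (mrun step z z s z.length) (some a) (some a) := by
      intro z a
      simp only [List.length_append, List.length_singleton, mrun]
      rw [mrun_congr step (u' := z) (v' := z)]
      · simp
      · intro k hk; simp [List.getElem?_append, hk]
      · intro k hk; simp [List.getElem?_append, hk]
    intro z z' a h
    simp only [this, h]
  · intro z z' h hz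
    simp only [Set.mem_ofPred_eq] at hz ⊢
    rw [hR z z _ le_rfl le_rfl] at hz
    rw [hR z' z' _ le_rfl le_rfl]
    rwa [← h]

theorem Mach.union {α β : Type} {R T : Set (List α × List β)} (h : Mach R) (h' : Mach T) :
    Mach (R ∪ T) := by
  obtain ⟨Q, hQ, step, s, acc, hR⟩ := h
  obtain ⟨Q', hQ', step', s', acc', hR'⟩ := h'
  have : ∀ u v n, mrun (fun (q : Q × Q') x y => (step q.1 x y, step' q.2 x y)) u v (s, s') n
    = (mrun step u v s n, mrun step' u v s' n) := by
    intro u v n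
    induction n with
    | zero => rfl
    | succ n ih => simp only [mrun, ih]
  refine ⟨Q × Q', inferInstance, fun q x y => (step q.1 x y, step' q.2 x y), (s, s'), {q | q.1 ∈ acc ∨ q.2 ∈ acc'}, fun u v n hu hv => ?_⟩
  rw [this, Set.mem_union, hR u v n hu hv, hR' u v n hu hv]; rfl

theorem Mach.compl {α β : Type} {R : Set (List α × List β)} (h : Mach R) : Mach Rᶜ := by
  obtain ⟨Q, hQ, step, s, acc, hR⟩ := h
  refine ⟨Q, hQ, step, s, accᶜ, fun u v n hu hv => ?_⟩
  rw [Set.mem_compl_iff, hR u v n hu hv]; rfl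

theorem Mach.inter {α β : Type} {R T : Set (List α × List β)} (h : Mach R) (h' : Mach T) :
    Mach (R ∩ T) := by
  have := (h.compl.union h'.compl).compl
  rwa [Set.compl_union, compl_compl, compl_compl] at this

theorem Mach.const {α β : Type} (p : Prop) : Mach {_x : List α × List β | p} :=
  ⟨Unit, inferInstance, fun _ _ _ => (), (), {_x | p}, fun _ _ _ _ _ => Iff.rfl⟩

theorem Mach.iUnion {α β ι : Type} [Finite ι] {R : ι → Set (List α × List β)}
    (h : ∀ i, Mach (R i)) : Mach (⋃ i, R i) := by
  choose Q hQ step s acc hR using h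
  have : ∀ u v n, mrun (fun (q : ∀ i, Q i) x y => fun i => step i (q i) x y) u v s n
    = fun i => mrun (step i) u v (s i) n := by
    intro u v n
    induction n with
    | zero => rfl
    | succ n ih => simp only [mrun, ih]
  refine ⟨∀ i, Q i, inferInstance, fun q x y i => step i (q i) x y, s, {q | ∃ i, q i ∈ acc i}, fun u v n hu hv => ?_⟩
  rw [this, Set.mem_iUnion]
  exact exists_congr fun i => hR i u v n hu hv

theorem Mach.swap {α β : Type} {R : Set (List α × List β)} (h : Mach R) :
    Mach {p : List β × List α | (p.2, p.1) ∈ R} := by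
  obtain ⟨Q, hQ, step, s, acc, hR⟩ := h
  have : ∀ u v n, mrun (fun q x y => step q y x) u v s n = mrun step v u s n := by
    intro u v n
    induction n with
    | zero => rfl
    | succ n ih => simp only [mrun, ih]
  refine ⟨Q, hQ, fun q x y => step q y x, s, acc, fun u v n hu hv => ?_⟩
  rw [this]; exact hR v u n hv hu

theorem Mach.left {α β : Type} {L : Set (List α)} (h : IsRegularSet L) :
    Mach {p : List α × List β | p.1 ∈ L} := by
  obtain ⟨Q, hQ, step, s, acc, hL⟩ := reg_dfa h
  refine ⟨Q, hQ, fun q x _ => match x with | some a => step q a | none => q, s, acc, ?_⟩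
  intro u v n hu hv
  have : ∀ n, mrun (fun q x (_ : Option β) => match x with | some a => step q a | none => q) u v s n
    = (u.take n).foldl step s := by
    intro n
    induction n with
    | zero => rfl
    | succ n ih =>
      simp only [mrun, ih, List.take_add_one, List.foldl_append]
      cases u[n]? <;> rfl
  rw [this, List.take_of_length_le hu]
  exact hL u

theorem Mach.right {α β : Type} {L : Set (List β)} (h : IsRegularSet L) :
    Mach {p : List α × List β | p.2 ∈ L} :=
  Mach.swap (Mach.left (α := β) (β := α) h)

theorem Mach.comp {α β γ : Type} {R : Set (List α × List β)} {T : Set (List β × List γ)}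
    (h : Mach R) (h' : Mach T) :
    Mach {p : List α × List γ | ∃ z, (p.1, z) ∈ R ∧ (z, p.2) ∈ T} := by
  obtain ⟨Q, hQ, step, s, acc, hR⟩ := h
  obtain ⟨Q', hQ', step', s', acc', hR'⟩ := h'
  let stp : Set (Q × Q' × Prop) → Option α → Option γ → Set (Q × Q' × Prop) := fun U x y =>
    {r | ∃ q ∈ U, ∃ z : Option β, (q.2.2 → z = none) ∧
      r = (step q.1 x z, step' q.2.1 z y, z = none)}
  have key : ∀ u v n, mrun stp u v {(s, s', False)} n =
      {r | ∃ z : List β, z.length ≤ n ∧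
        r = (mrun step u z s n, mrun step' z v s' n, (z.length < n))} := by
    intro u v n
    induction n with
    | zero =>
      ext r
      simp only [mrun, Set.mem_singleton_iff, Set.mem_ofPred_eq]
      constructor
      · rintro rfl; exact ⟨[], le_rfl, by simp⟩
      · rintro ⟨z, _, rfl⟩; simp
    | succ n ih =>
      ext r
      simp only [mrun, ih]
      constructor
      · rintro ⟨q, ⟨z, hz, rfl⟩, o, ho, rfl⟩
        cases o with
        | none =>
          refine ⟨z, by omega, ?_⟩
          have : z[n]? = none := by simp; omega
          simp only [this]
          simp; omega
        | some b =>
          have hz' : z.length = n := by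
            have := ho
            simp at this
            omega
          refine ⟨z ++ [b], by simp; omega, ?_⟩
          have e1 : (z ++ [b])[n]? = some b := by rw [← hz']; simp
          have e2 : ∀ k < n, z[k]? = (z ++ [b])[k]? := by
            intro k hk; rw [List.getElem?_append_left (by omega)]
          rw [e1, mrun_congr step s (fun _ _ => rfl) e2, mrun_congr step' s' e2 (fun _ _ => rfl)]
          simp [hz']
      · rintro ⟨z, hz, rfl⟩
        refine ⟨_, ⟨z.take n, by simp, rfl⟩, z[n]?, ?_, ?_⟩
        · simp; omega
        · have e2 : ∀ k < n, z[k]? = (z.take n)[k]? := by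
            intro k hk; simp [hk]
          rw [mrun_congr step s (fun _ _ => rfl) e2, mrun_congr step' s' e2 (fun _ _ => rfl)]
          simp only [Prod.mk.injEq, true_and, eq_iff_iff]
          rw [List.getElem?_eq_none_iff]; omega
  refine ⟨Set (Q × Q' × Prop), inferInstance, stp, {(s, s', False)},
    {U | ∃ q ∈ U, ∃ r : List β, (q.2.2 → r = []) ∧ mrun step [] r q.1 r.length ∈ acc ∧
      mrun step' r [] q.2.1 r.length ∈ acc'}, fun u v n hu hv => ?_⟩
  rw [key]
  constructor
  · rintro ⟨z, h1, h2⟩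
    simp only at h1 h2
    refine ⟨_, ⟨z.take n, by simp, rfl⟩, z.drop n, ?_, ?_, ?_⟩
    · simp; omega
    · have e2 : ∀ k < n, (z.take n)[k]? = z[k]? := by
        intro k hk; simp [hk]
      rw [mrun_congr step s (fun _ _ => rfl) e2, ← mrun_add, ← hR] <;> first | exact h1 | skip
      · omega
      · simp; omega
      · intro k hk; simp; omega
      · intro k hk; simp
    · have e2 : ∀ k < n, (z.take n)[k]? = z[k]? := by
        intro k hk; simp [hk]
      rw [mrun_congr step' s' e2 (fun _ _ => rfl), ← mrun_add, ← hR'] <;> first | exact h2 | skip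
      · simp; omega
      · omega
      · intro k hk; simp
      · intro k hk; simp; omega
  · rintro ⟨_, ⟨z, hz, rfl⟩, r, h1, h2, h3⟩
    simp only at h1 h2 h3
    have hr : z.length = n ∨ r = [] := by
      by_cases h : z.length < n
      · exact Or.inr (h1 h)
      · left; omega
    have e1 : ∀ k < n, z[k]? = (z ++ r)[k]? := by
      intro k hk
      rcases hr with hr | hr
      · rw [List.getElem?_append_left (by omega)]
      · simp [hr]
    have e3 : ∀ k < r.length, (z ++ r)[n + k]? = r[k]? := by
      intro k hk
      rcases hr with hr | hr
      · rw [List.getElem?_append_right (by omega)]; congr 1; omega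
      · simp [hr] at hk
    have e4 : ∀ k < r.length, u[n + k]? = ([] : List α)[k]? := by intro k hk; simp; omega
    have e5 : ∀ k < r.length, v[n + k]? = ([] : List γ)[k]? := by intro k hk; simp; omega
    have e6 : (z ++ r).length ≤ n + r.length := by simp; omega
    refine ⟨z ++ r, ?_, ?_⟩
    · rw [mrun_congr step s (fun _ _ => rfl) e1, ← mrun_add step s e4 e3, ← hR] at h2
      · exact h2
      · omega
      · exact e6
    · rw [mrun_congr step' s' e1 (fun _ _ => rfl), ← mrun_add step' s' e3 e5, ← hR'] at h3
      · exact h3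
      · exact e6
      · omega


theorem delta_nil {V E : Type} (etgt : E → V) : deltaPair etgt [] [] = [] := by
  simp [deltaPair]

theorem delta_snoc_both {V E : Type} (etgt : E → V) {a b : List E} (e f : E)
    (h : a.length = b.length) : deltaPair etgt (a ++ [e]) (b ++ [f])
      = deltaPair etgt a b ++ [(Sum.inl e, Sum.inl f)] := by
  simp [deltaPair, h, List.zip_append]

theorem delta_snoc_left {V E : Type} (etgt : E → V) {a b : List E} (e : E)
    (h : b.length ≤ a.length) : deltaPair etgt (a ++ [e]) b
      = deltaPair etgt a b ++ [(Sum.inl e, padSym etgt b)] := by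
  have h1 : ¬ (a ++ [e]).length ≤ b.length := by simp; omega
  have h3 : ((a ++ [e]).map (Sum.inl (β := Option V))).zip (b.map (Sum.inl (β := Option V)))
      = (a.map Sum.inl).zip (b.map Sum.inl) := by
    rw [List.zip_eq_zip_take_min]
    conv_rhs => rw [List.zip_eq_zip_take_min]
    simp [List.take_append, h, Nat.le_succ_of_le h]
  have h4 : (a ++ [e]).drop b.length = a.drop b.length ++ [e] := by
    rw [List.drop_append_of_le_length h]
  unfold deltaPair
  rw [if_neg h1, h3, h4]
  split_ifs with h5
  · have : a.length = b.length := by omega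
    rw [← this]; simp [this]
  · simp

theorem delta_snoc_right {V E : Type} (etgt : E → V) {a b : List E} (f : E)
    (h : a.length ≤ b.length) : deltaPair etgt a (b ++ [f])
      = deltaPair etgt a b ++ [(padSym etgt a, Sum.inl f)] := by
  have h1 : a.length ≤ (b ++ [f]).length := by simp; omega
  have h3 : (a.map (Sum.inl (β := Option V))).zip ((b ++ [f]).map (Sum.inl (β := Option V)))
      = (a.map Sum.inl).zip (b.map Sum.inl) := by
    rw [List.zip_eq_zip_take_min]
    conv_rhs => rw [List.zip_eq_zip_take_min]
    simp [List.take_append, h, Nat.le_succ_of_le h]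
  have h4 : (b ++ [f]).drop a.length = b.drop a.length ++ [f] := by
    rw [List.drop_append_of_le_length h]
  unfold deltaPair
  rw [if_pos h1, h3, h4, if_pos h]
  simp

/-- Inductive description of pairs of words by simultaneous growth. -/
theorem pair_ind {E : Type} {p : List E → List E → Prop} (h0 : p [] [])
    (h1 : ∀ a b e f, a.length = b.length → p a b → p (a ++ [e]) (b ++ [f]))
    (h2 : ∀ a b e, b.length ≤ a.length → p a b → p (a ++ [e]) b)
    (h3 : ∀ a b f, a.length ≤ b.length → p a b → p a (b ++ [f])) : ∀ a b, p a b := by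
  have : ∀ n a b, a.length + b.length = n → p a b := by
    intro n
    induction n using Nat.strong_induction_on with
    | _ n ih =>
      intro a b hn
      rcases List.eq_nil_or_concat a with rfl | ⟨a', e, rfl⟩
      · rcases List.eq_nil_or_concat b with rfl | ⟨b', f, rfl⟩
        · exact h0
        · rw [List.concat_eq_append] at hn ⊢
          refine h3 _ _ _ (by simp) (ih _ ?_ _ _ rfl)
          rw [← hn]; simp
      · rcases List.eq_nil_or_concat b with rfl | ⟨b', f, rfl⟩
        · rw [List.concat_eq_append] at hn ⊢
          refine h2 _ _ _ (by simp) (ih _ ?_ _ _ rfl)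
          rw [← hn]; simp
        · simp only [List.concat_eq_append, List.length_append, List.length_singleton] at *
          rcases lt_trichotomy a'.length b'.length with h | h | h
          · refine h3 _ _ _ ?_ (ih _ ?_ _ _ rfl)
            · simp only [List.length_append, List.length_singleton]; omega
            · simp only [List.length_append, List.length_singleton]; omega
          · exact h1 _ _ _ _ h (ih _ (by omega) _ _ rfl)
          · refine h2 _ _ _ ?_ (ih _ ?_ _ _ rfl)
            · simp only [List.length_append, List.length_singleton]; omega
            · simp only [List.length_append, List.length_singleton]; omega
  exact fun a b => this _ a b rfl

theorem delta_left {V E : Type} (etgt : E → V) (a b : List E) :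
    (deltaPair etgt a b).filterMap (fun x => x.1.getLeft?) = a := by
  induction a, b using pair_ind with
  | h0 => simp [delta_nil]
  | h1 a b e f h ih => simp [delta_snoc_both etgt e f h, ih]
  | h2 a b e h ih => simp [delta_snoc_left etgt e h, ih]
  | h3 a b f h ih => simp [delta_snoc_right etgt f h, ih, padSym]

theorem delta_right {V E : Type} (etgt : E → V) (a b : List E) :
    (deltaPair etgt a b).filterMap (fun x => x.2.getLeft?) = b := by
  induction a, b using pair_ind with
  | h0 => simp [delta_nil]
  | h1 a b e f h ih => simp [delta_snoc_both etgt e f h, ih]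
  | h2 a b e h ih => simp [delta_snoc_left etgt e h, ih, padSym]
  | h3 a b f h ih => simp [delta_snoc_right etgt f h, ih]

theorem delta_inj {V E : Type} (etgt : E → V) {a b a' b' : List E}
    (h : deltaPair etgt a b = deltaPair etgt a' b') : a = a' ∧ b = b' :=
  ⟨by rw [← delta_left etgt a b, h, delta_left], by rw [← delta_right etgt a b, h, delta_right]⟩

theorem delta_view {V E : Type} (etgt : E → V) (a b : List E) :
    (a = [] ∧ b = []) ∨ ∃ a' b' c, deltaPair etgt a b = deltaPair etgt a' b' ++ [c] ∧
      ((∃ e f, a'.length = b'.length ∧ a = a' ++ [e] ∧ b = b' ++ [f] ∧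
          c = (Sum.inl e, Sum.inl f)) ∨
       (∃ e, b'.length ≤ a'.length ∧ a = a' ++ [e] ∧ b = b' ∧
          c = (Sum.inl e, padSym etgt b')) ∨
       (∃ f, a'.length ≤ b'.length ∧ a = a' ∧ b = b' ++ [f] ∧
          c = (padSym etgt a', Sum.inl f))) := by
  induction a, b using pair_ind with
  | h0 => simp
  | h1 a b e f h ih =>
    exact Or.inr ⟨a, b, _, delta_snoc_both etgt e f h, Or.inl ⟨e, f, h, rfl, rfl, rfl⟩⟩
  | h2 a b e h ih =>
    exact Or.inr ⟨a, b, _, delta_snoc_left etgt e h, Or.inr (Or.inl ⟨e, h, rfl, rfl, rfl⟩)⟩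
  | h3 a b f h ih =>
    exact Or.inr ⟨a, b, _, delta_snoc_right etgt f h, Or.inr (Or.inr ⟨f, h, rfl, rfl, rfl⟩)⟩

theorem mach_of_sync {V E : Type} [Finite E] (etgt : E → V) {R : Set (List E × List E)}
    (h : SyncRegular etgt R) : Mach R := by
  obtain ⟨Q, hQ, d, s, acc, hL⟩ := reg_dfa h
  classical
  let sym : Option E → Option E → E ⊕ Option V := fun l x =>
    match x with
    | some e => Sum.inl e
    | none => Sum.inr (l.map etgt)
  let step : Q × Option E × Option E → Option E → Option E → Q × Option E × Option E :=
    fun q x y => if x = none ∧ y = none then q else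
      (d q.1 (sym q.2.1 x, sym q.2.2 y), x.or q.2.1, y.or q.2.2)
  have hpad : ∀ (a b : List E) k, mrun step a b (s, none, none) (max a.length b.length + k)
      = mrun step a b (s, none, none) (max a.length b.length) := by
    intro a b k
    induction k with
    | zero => rfl
    | succ k ih =>
      rw [← Nat.add_assoc]
      simp only [mrun]
      have e1 : a[max a.length b.length + k]? = none := by simp; omega
      have e2 : b[max a.length b.length + k]? = none := by simp; omega
      rw [ih, e1, e2]
      simp [step]
  have key : ∀ a b : List E, mrun step a b (s, none, none) (max a.length b.length)
      = ((deltaPair etgt a b).foldl d s, a.getLast?, b.getLast?) := by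
    intro a b
    have ap : ∀ (a : List E) (e : E), ∀ k < a.length, (a ++ [e])[k]? = a[k]? := by
      intro a e k hk; rw [List.getElem?_append_left hk]
    induction a, b using pair_ind with
    | h0 => simp [mrun, delta_nil]
    | h1 a b e f h ih =>
      have hm : max (a ++ [e]).length (b ++ [f]).length = max a.length b.length + 1 := by
        simp only [List.length_append, List.length_singleton]; omega
      rw [hm, delta_snoc_both etgt e f h]
      simp only [mrun]
      rw [mrun_congr step (u' := a) (v' := b), ih]
      · have hm2 : max a.length b.length = a.length := by omega
        have e1 : (b ++ [f])[a.length]? = some f := by rw [h]; simp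
        rw [hm2, e1]
        simp [step, sym]
      · intro k hk; exact ap _ _ _ (by omega)
      · intro k hk; exact ap _ _ _ (by omega)
    | h2 a b e h ih =>
      have hm : max (a ++ [e]).length b.length = max a.length b.length + 1 := by
        simp; omega
      rw [hm, delta_snoc_left etgt e h]
      simp only [mrun]
      rw [mrun_congr step (u' := a) (v' := b), ih]
      · have hm2 : max a.length b.length = a.length := by omega
        have e1 : b[a.length]? = none := by simp; omega
        rw [hm2, e1]
        simp [step, sym, padSym]
      · intro k hk; exact ap _ _ _ (by omega)
      · intro k hk; rfl
    | h3 a b f h ih =>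
      have hm : max a.length (b ++ [f]).length = max a.length b.length + 1 := by
        simp only [List.length_append, List.length_singleton]; omega
      rw [hm, delta_snoc_right etgt f h]
      simp only [mrun]
      rw [mrun_congr step (u' := a) (v' := b), ih]
      · have hm2 : max a.length b.length = b.length := by omega
        have e1 : a[b.length]? = none := by simp; omega
        rw [hm2, e1]
        simp [step, sym, padSym]
      · intro k hk; rfl
      · intro k hk; exact ap _ _ _ (by omega)
  refine ⟨Q × Option E × Option E, inferInstance, step, (s, none, none), {q | q.1 ∈ acc}, ?_⟩
  intro u v n hu hv
  obtain ⟨k, rfl⟩ : ∃ k, n = max u.length v.length + k := ⟨n - max u.length v.length, by omega⟩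
  rw [hpad, key]
  have := hL (deltaPair etgt u v)
  constructor
  · intro h; exact this.1 ⟨(u, v), h, rfl⟩
  · intro h
    obtain ⟨⟨u', v'⟩, h1, h2⟩ := this.2 h
    obtain ⟨rfl, rfl⟩ := delta_inj etgt h2
    exact h1

theorem sync_of_mach {V E : Type} [Finite E] (etgt : E → V) {R : Set (List E × List E)}
    (h : Mach R) : SyncRegular etgt R := by
  obtain ⟨Q, hQ, step, s, acc, hR⟩ := h
  classical
  let stuff : List E → List E → Q × Option E × Option E × Prop × Prop := fun a b =>
    (mrun step a b s (max a.length b.length), a.getLast?, b.getLast?, a.length ≤ b.length,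
      b.length ≤ a.length)
  have ap : ∀ (a : List E) (e : E), ∀ k < a.length, (a ++ [e])[k]? = a[k]? := by
    intro a e k hk; rw [List.getElem?_append_left hk]
  have s1 : ∀ a b e f, a.length = b.length → stuff (a ++ [e]) (b ++ [f]) =
      (step (stuff a b).1 (some e) (some f), some e, some f, True, True) := by
    intro a b e f h
    have hm : max (a ++ [e]).length (b ++ [f]).length = max a.length b.length + 1 := by
      simp only [List.length_append, List.length_singleton]; omega
    simp only [stuff, hm, mrun]
    rw [mrun_congr step (u' := a) (v' := b)]
    · have hm2 : max a.length b.length = a.length := by omega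
      have e1 : (b ++ [f])[a.length]? = some f := by rw [h]; simp
      rw [hm2, e1]
      simp [h]
    · intro k hk; exact ap _ _ _ (by omega)
    · intro k hk; exact ap _ _ _ (by omega)
  have s2 : ∀ a b e, b.length ≤ a.length → stuff (a ++ [e]) b =
      (step (stuff a b).1 (some e) none, some e, b.getLast?, False, True) := by
    intro a b e h
    have hm : max (a ++ [e]).length b.length = max a.length b.length + 1 := by
      simp; omega
    simp only [stuff, hm, mrun]
    rw [mrun_congr step (u' := a) (v' := b)]
    · have hm2 : max a.length b.length = a.length := by omega
      have e1 : b[a.length]? = none := by simp; omega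
      rw [hm2, e1]
      simp; omega
    · intro k hk; exact ap _ _ _ (by omega)
    · intro k hk; rfl
  have s3 : ∀ a b f, a.length ≤ b.length → stuff a (b ++ [f]) =
      (step (stuff a b).1 none (some f), a.getLast?, some f, True, False) := by
    intro a b f h
    have hm : max a.length (b ++ [f]).length = max a.length b.length + 1 := by
      simp only [List.length_append, List.length_singleton]; omega
    simp only [stuff, hm, mrun]
    rw [mrun_congr step (u' := a) (v' := b)]
    · have hm2 : max a.length b.length = b.length := by omega
      have e1 : a[b.length]? = none := by simp; omega
      rw [hm2, e1]
      simp; omega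
    · intro k hk; rfl
    · intro k hk; exact ap _ _ _ (by omega)
  let f : List ((E ⊕ Option V) × (E ⊕ Option V)) → Set (Q × Option E × Option E × Prop × Prop) :=
    fun z => {r | ∃ a b, z = deltaPair etgt a b ∧ r = stuff a b}
  have fd : ∀ a b r, r ∈ f (deltaPair etgt a b) ↔ r = stuff a b := by
    intro a b r
    constructor
    · rintro ⟨a', b', h1, rfl⟩
      obtain ⟨rfl, rfl⟩ := delta_inj etgt h1
      rfl
    · rintro rfl; exact ⟨a, b, rfl, rfl⟩
  have half : ∀ z z' c, f z = f z' → f (z ++ [c]) ⊆ f (z' ++ [c]) := by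
    rintro z z' c h r ⟨a, b, h1, rfl⟩
    rcases delta_view etgt a b with ⟨rfl, rfl⟩ | ⟨a', b', c', h2, h3⟩
    · simp [delta_nil] at h1
    rw [h2] at h1
    obtain ⟨hz, hc⟩ := List.append_inj' h1 rfl
    obtain rfl : c = c' := by simpa using hc
    subst hz
    have : stuff a' b' ∈ f z' := by rw [← h, fd]
    obtain ⟨a'', b'', rfl, h4⟩ := this
    have h5 := h4
    simp only [stuff, Prod.mk.injEq, eq_iff_iff] at h5
    obtain ⟨-, h51, h52, h53, h54⟩ := h5
    rcases h3 with ⟨e, g, h6, rfl, rfl, rfl⟩ | ⟨e, h6, rfl, rfl, rfl⟩ | ⟨e, h6, rfl, rfl, rfl⟩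
    · have h7 : a''.length = b''.length := le_antisymm (h53.1 h6.le) (h54.1 h6.ge)
      rw [← delta_snoc_both etgt e g h7, fd, s1 _ _ _ _ h6, s1 _ _ _ _ h7, h4]
    · have h7 := h54.1 h6
      have : padSym etgt b = padSym etgt b'' := by simp [padSym, h52]
      rw [this, ← delta_snoc_left etgt e h7, fd, s2 _ _ _ h6, s2 _ _ _ h7, h4, h52]
    · have h7 := h53.1 h6
      have : padSym etgt a = padSym etgt a'' := by simp [padSym, h51]
      rw [this, ← delta_snoc_right etgt e h7, fd, s3 _ _ _ h6, s3 _ _ _ h7, h4, h51]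
  refine reg_of_map _ f (fun z z' c h => Set.Subset.antisymm (half z z' c h) (half z' z c h.symm)) ?_
  rintro z z' h ⟨⟨a, b⟩, hR1, rfl⟩
  simp only at h
  have : stuff a b ∈ f z' := by rw [← h, fd]
  obtain ⟨a', b', rfl, h4⟩ := this
  refine ⟨(a', b'), ?_, rfl⟩
  rw [hR _ _ (max a.length b.length) (by omega) (by omega)] at hR1
  rw [hR _ _ (max a'.length b'.length) (by omega) (by omega)]
  have : (stuff a b).1 = (stuff a' b').1 := by rw [h4]
  simp only [stuff] at this
  rwa [← this]

theorem reg_dropLast {α : Type} (p : α → Prop) :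
    IsRegularSet {w : List α | ∀ l ∈ w.dropLast, p l} := by
  refine reg_of_map (Q := Prop × Prop) _ (fun z => (∀ l ∈ z.dropLast, p l, ∀ l ∈ z, p l)) ?_ ?_
  · intro z z' a h
    simp only [Prod.mk.injEq, eq_iff_iff] at h
    simp only [List.dropLast_concat, Prod.mk.injEq, eq_iff_iff, List.forall_mem_append, h.2]
  · intro z z' h hz
    simp only [Prod.mk.injEq, eq_iff_iff] at h
    exact h.1.1 hz

theorem reg_tail {α : Type} (p : α → Prop) :
    IsRegularSet {w : List α | ∀ l ∈ w.tail, p l} := by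
  refine reg_of_map (Q := Prop × Prop) _ (fun z => (∀ l ∈ z.tail, p l, z = [])) ?_ ?_
  · intro z z' a h
    simp only [Prod.mk.injEq, eq_iff_iff] at h
    cases z <;> cases z' <;> simp at h ⊢
    simp only [or_imp, forall_and, h]
  · intro z z' h hz
    simp only [Prod.mk.injEq, eq_iff_iff] at h
    exact h.1.1 hz

theorem reg_head {α : Type} (p : α → Prop) :
    IsRegularSet {w : List α | ∃ l, w.head? = some l ∧ p l} := by
  refine reg_of_map (Q := Prop × Prop) _ (fun z => (∃ l, z.head? = some l ∧ p l, z = [])) ?_ ?_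
  · intro z z' a h
    simp only [Prod.mk.injEq, eq_iff_iff] at h
    cases z <;> cases z' <;> simp at h ⊢
    exact h
  · intro z z' h hz
    simp only [Prod.mk.injEq, eq_iff_iff] at h
    exact h.1.1 hz

theorem reg_last {α : Type} (p : α → Prop) :
    IsRegularSet {w : List α | ∃ l, w.getLast? = some l ∧ p l} := by
  refine reg_of_map (Q := Prop) _ (fun z => (∃ l, z.getLast? = some l ∧ p l)) ?_ ?_
  · intro z z' a h
    simp
  · intro z z' h hz
    exact (iff_of_eq h).1 hz

theorem Mach.restrict {α β : Type} {D R : Set (List α × List β)} (hD : Mach D)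
    {Q : Type} [Finite Q] (step : Q → Option α → Option β → Q) (s : Q) (acc : Set Q)
    (hR : ∀ u v n, u.length ≤ n → v.length ≤ n → (u, v) ∈ D →
      ((u, v) ∈ R ↔ mrun step u v s n ∈ acc)) : Mach (D ∩ R) := by
  obtain ⟨Q', hQ', step', s', acc', hR'⟩ := hD
  have : ∀ u v n, mrun (fun (q : Q × Q') x y => (step q.1 x y, step' q.2 x y)) u v (s, s') n
    = (mrun step u v s n, mrun step' u v s' n) := by
    intro u v n
    induction n with
    | zero => rfl
    | succ n ih => simp only [mrun, ih]
  refine ⟨Q × Q', inferInstance, fun q x y => (step q.1 x y, step' q.2 x y), (s, s'),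
    {q | q.2 ∈ acc' ∧ q.1 ∈ acc}, fun u v n hu hv => ?_⟩
  rw [this, Set.mem_inter_iff]
  refine Iff.trans (and_congr_right fun h => hR u v n hu hv h) ?_
  rw [hR' u v n hu hv]; rfl

/-- Block decoding preserves machine-recognisability. -/
theorem Mach.pull {α ε : Type} [Finite ε] (N : ℕ) (c : α → List ε)
    (hc : ∀ a, (c a).length ≤ 2 * N) {R : Set (List ε × List ε)} (h : Mach R) :
    Mach (({p : List α × List α | p.1 ∈ {w : List α | ∀ l ∈ w.dropLast, (c l).length = N}} ∩
      {p | p.2 ∈ {w : List α | ∀ l ∈ w.dropLast, (c l).length = N}}) ∩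
      {p | (p.1.flatMap c, p.2.flatMap c) ∈ R}) := by
  obtain ⟨Q, hQ, step, s, acc, hR⟩ := h
  let P := {l : List ε // l.length ≤ N}
  have hP : Finite P := (List.finite_length_le ε N).to_subtype
  let buf : P → Option α → List ε := fun p x => p.1 ++ (x.map c).getD []
  let stp : Q × P × P → Option α → Option α → Q × P × P := fun q x y =>
    (mrun step (buf q.2.1 x) (buf q.2.2 y) q.1 N,
      ⟨((buf q.2.1 x).drop N).take N, by simp⟩, ⟨((buf q.2.2 y).drop N).take N, by simp⟩)
  let s0 : Q × P × P := (s, ⟨[], by simp⟩, ⟨[], by simp⟩)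
  let acc' : Set (Q × P × P) := {q | mrun step q.2.1.1 q.2.2.1 q.1 N ∈ acc}
  -- length facts
  have len1 : ∀ w : List α, (∀ l ∈ w.dropLast, (c l).length = N) → ∀ t, t < w.length →
      ((w.take t).flatMap c).length = N * t := by
    intro w hw t
    induction t with
    | zero => simp
    | succ t ih =>
      intro ht
      rw [List.take_add_one, List.flatMap_append, List.length_append, ih (by omega),
        List.getElem?_eq_getElem (by omega)]
      have : w[t] ∈ w.dropLast := by
        rw [List.mem_iff_getElem]
        exact ⟨t, by simp; omega, by simp⟩
      simp [hw _ this]; ring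
  have len2 : ∀ w : List α, (∀ l ∈ w.dropLast, (c l).length = N) →
      (w.flatMap c).length ≤ N * (w.length + 1) := by
    intro w hw
    rcases List.eq_nil_or_concat w with rfl | ⟨w', l, rfl⟩
    · simp
    · have h1 := len1 _ hw w'.length (by simp)
      have h2 := hc l
      simp at h1 ⊢
      rw [h1]; linarith
  have bufl : ∀ w : List α, (∀ l ∈ w.dropLast, (c l).length = N) → ∀ t,
      ((w.take t).flatMap c).drop (N * t) ++ (w[t]?.map c).getD []
        = ((w.take (t + 1)).flatMap c).drop (N * t) := by
    intro w hw t
    rw [List.take_add_one, List.flatMap_append]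
    by_cases ht : t < w.length
    · rw [List.getElem?_eq_getElem ht, List.drop_append_of_le_length (by rw [len1 w hw t ht])]
      simp
    · have : w[t]? = none := by simp; omega
      simp [this]
  have short : ∀ w : List α, (∀ l ∈ w.dropLast, (c l).length = N) → ∀ t,
      ((w.take t).flatMap c).length ≤ N * t + N := by
    intro w hw t
    by_cases ht : t < w.length
    · rw [len1 w hw t ht]; omega
    · rw [List.take_of_length_le (by omega)]
      have := len2 w hw
      calc _ ≤ _ := this
        _ = N * w.length + N := by ring
        _ ≤ _ := by gcongr; omega
  have idx : ∀ w : List α, (∀ l ∈ w.dropLast, (c l).length = N) → ∀ t, ∀ k < N,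
      (w.flatMap c)[N * t + k]? = (((w.take (t + 1)).flatMap c).drop (N * t))[k]? := by
    intro w hw t k hk
    rw [List.getElem?_drop]
    by_cases ht : t + 1 < w.length
    · conv_lhs => rw [← List.take_append_drop (t + 1) w, List.flatMap_append]
      rw [List.getElem?_append_left]
      rw [len1 w hw _ ht]
      have : N * (t + 1) = N * t + N := by ring
      omega
    · rw [List.take_of_length_le (by omega)]
  have inv : ∀ w w' : List α, (∀ l ∈ w.dropLast, (c l).length = N) →
      (∀ l ∈ w'.dropLast, (c l).length = N) → ∀ t,
      (mrun stp w w' s0 t).1 = mrun step (w.flatMap c) (w'.flatMap c) s (N * t) ∧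
      (mrun stp w w' s0 t).2.1.1 = ((w.take t).flatMap c).drop (N * t) ∧
      (mrun stp w w' s0 t).2.2.1 = ((w'.take t).flatMap c).drop (N * t) := by
    intro w w' hw hw' t
    induction t with
    | zero => simp [mrun, s0]
    | succ t ih =>
      obtain ⟨i1, i2, i3⟩ := ih
      have b1 : buf (mrun stp w w' s0 t).2.1 w[t]? = ((w.take (t + 1)).flatMap c).drop (N * t) := by
        simp only [buf]; rw [i2, bufl w hw]
      have b2 : buf (mrun stp w w' s0 t).2.2 w'[t]?
          = ((w'.take (t + 1)).flatMap c).drop (N * t) := by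
        simp only [buf]; rw [i3, bufl w' hw']
      have hN : N * (t + 1) = N * t + N := by ring
      refine ⟨?_, ?_, ?_⟩
      · simp only [mrun, stp]
        rw [b1, b2, i1, hN, mrun_add step s (idx w hw t) (idx w' hw' t)]
      · simp only [mrun, stp]
        rw [b1, List.drop_drop, ← hN, List.take_of_length_le]
        have := short w hw (t + 1)
        simp only [List.length_drop]; omega
      · simp only [mrun, stp]
        rw [b2, List.drop_drop, ← hN, List.take_of_length_le]
        have := short w' hw' (t + 1)
        simp only [List.length_drop]; omega
  refine Mach.restrict ((Mach.left (reg_dropLast _)).inter (Mach.right (reg_dropLast _)))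
    stp s0 acc' ?_
  rintro w w' n hn hn' ⟨hw, hw'⟩
  obtain ⟨i1, i2, i3⟩ := inv w w' hw hw' n
  have l1 : (w.flatMap c).length ≤ N * n + N := by
    refine (len2 w hw).trans ?_
    rw [Nat.mul_add, Nat.mul_one]; gcongr
  have l2 : (w'.flatMap c).length ≤ N * n + N := by
    refine (len2 w' hw').trans ?_
    rw [Nat.mul_add, Nat.mul_one]; gcongr
  have := hR (w.flatMap c) (w'.flatMap c) (N * n + N) l1 l2
  refine Iff.trans this ?_
  rw [mrun_add step s (idx w hw n) (idx w' hw' n)]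
  show _ ↔ mrun step _ _ _ N ∈ acc
  rw [i1, i2, i3, List.take_of_length_le hn, List.take_of_length_le hn',
    List.take_of_length_le (by omega), List.take_of_length_le (by omega)]


/-! ### Evaluating paths in a semigroupoid -/

/-- The non-empty path `u` evaluates to the arrow `x`. -/
def Ev {O A E : Type} {S : Sgpd O A} (C : ChoiceOfReps S.toPreSgpd E) (u : List E) (x : A) :
    Prop :=
  u ≠ [] ∧ IsPathChain C.esrc C.etgt u ∧ evalPath? S.toPreSgpd C.lab u = some x

section
variable {O A E : Type} {S : Sgpd O A} {C : ChoiceOfReps S.toPreSgpd E}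

theorem Ev.unique {u : List E} {x y : A} (h : Ev C u x) (h' : Ev C u y) : x = y := by
  have := h.2.2.symm.trans h'.2.2
  simpa using this

theorem Ev.exists {u : List E} (h : u ≠ []) (h' : IsPathChain C.esrc C.etgt u) :
    ∃ x, Ev C u x := by
  cases u with
  | nil => exact absurd rfl h
  | cons a l => exact ⟨_, h, h', rfl⟩

theorem Ev.ofK {u : List E} (h : u ∈ C.K) : ∃ x, Ev C u x :=
  Ev.exists (C.K_path u h).1 (C.K_path u h).2

theorem Ev.onto (C : ChoiceOfReps S.toPreSgpd E) (x : A) : ∃ u ∈ C.K, Ev C u x := by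
  obtain ⟨u, hu, h⟩ := C.K_onto x
  exact ⟨u, hu, (C.K_path u hu).1, (C.K_path u hu).2, h⟩

theorem Ev.single (e : E) : Ev C [e] (C.lab e) :=
  ⟨by simp, List.isChain_singleton _, rfl⟩

theorem eval_snoc (S : PreSgpd O A) (lab : E → A) {u : List E} {x : A} (e : E)
    (h : evalPath? S lab u = some x) : evalPath? S lab (u ++ [e]) = some (S.mul x (lab e)) := by
  cases u with
  | nil => simp [evalPath?] at h
  | cons a l =>
    simp only [evalPath?, Option.some.injEq] at h
    simp [evalPath?, h]

theorem chain_append {V : Type} {s t : E → V} {p q : List E} :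
    IsPathChain s t (p ++ q) ↔ IsPathChain s t p ∧ IsPathChain s t q ∧
      ∀ x ∈ p.getLast?, ∀ y ∈ q.head?, t x = s y := List.isChain_append

theorem Ev.ends {u : List E} {x : A} (h : Ev C u x) :
    pathSrc? C.esrc u = some (S.src x) ∧ pathTgt? C.etgt u = some (S.tgt x) := by
  induction u using List.reverseRecOn generalizing x with
  | nil => exact absurd rfl h.1
  | append_singleton u e ih =>
    rcases eq_or_ne u [] with rfl | hu
    · have := h.unique (Ev.single e)
      subst this
      simp [pathSrc?, pathTgt?, C.lab_src, C.lab_tgt]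
    · obtain ⟨h1, h2, h3⟩ := chain_append.1 h.2.1
      obtain ⟨y, hy⟩ := Ev.exists (C := C) hu h1
      have h4 := eval_snoc S.toPreSgpd C.lab e hy.2.2
      rw [h.2.2] at h4
      obtain rfl : x = _ := by simpa using h4
      obtain ⟨i1, i2⟩ := ih hy
      have hc : S.tgt y = S.src (C.lab e) := by
        rw [C.lab_src]
        obtain ⟨l, hl⟩ : ∃ l, u.getLast? = some l := by
          rw [← Option.ne_none_iff_exists']; simpa using hu
        have := h3 l hl e (by simp)
        rw [← this]
        simp [pathTgt?, hl] at i2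
        exact i2.symm
      rw [S.src_mul _ _ hc, S.tgt_mul _ _ hc]
      constructor
      · rw [← i1]; cases u <;> simp [pathSrc?] at hu ⊢
      · simp [pathTgt?, C.lab_tgt]

theorem Ev.join_iff {p q : List E} {x y : A} (hp : Ev C p x) (hq : Ev C q y) :
    IsPathChain C.esrc C.etgt (p ++ q) ↔ S.tgt x = S.src y := by
  have h1 := hp.ends.2
  have h2 := hq.ends.1
  obtain ⟨l, hl⟩ : ∃ l, p.getLast? = some l := by
    rw [← Option.ne_none_iff_exists']; simpa using hp.1
  obtain ⟨m, hm⟩ : ∃ m, q.head? = some m := by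
    rw [← Option.ne_none_iff_exists']; simpa using hq.1
  simp [pathTgt?, pathSrc?, hl, hm] at h1 h2
  rw [chain_append, ← h1, ← h2]
  simp [hp.2.1, hq.2.1, hl, hm]

theorem Ev.mul {p q : List E} {x y : A} (hp : Ev C p x) (hq : Ev C q y)
    (h : S.tgt x = S.src y) : Ev C (p ++ q) (S.mul x y) := by
  refine ⟨by simp [hp.1], (hp.join_iff hq).2 h, ?_⟩
  induction q using List.reverseRecOn generalizing y with
  | nil => exact absurd rfl hq.1
  | append_singleton q e ih =>
    rcases eq_or_ne q [] with rfl | hu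
    · have := hq.unique (Ev.single e)
      subst this
      exact eval_snoc _ _ e hp.2.2
    · obtain ⟨h1, h2, h3⟩ := chain_append.1 hq.2.1
      obtain ⟨z, hz⟩ := Ev.exists (C := C) hu h1
      have h4 := eval_snoc S.toPreSgpd C.lab e hz.2.2
      rw [hq.2.2] at h4
      obtain rfl : y = _ := by simpa using h4
      have hc := (hz.join_iff (Ev.single e)).1 hq.2.1
      rw [S.src_mul _ _ hc] at h
      rw [← List.append_assoc, eval_snoc _ _ e (ih hz h), S.mul_assoc' _ _ _ h hc]

theorem Ev.split {p q : List E} {z : A} (hp : p ≠ []) (hq : q ≠ []) (h : Ev C (p ++ q) z) :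
    ∃ x y, Ev C p x ∧ Ev C q y ∧ S.tgt x = S.src y ∧ z = S.mul x y := by
  obtain ⟨h1, h2, h3⟩ := chain_append.1 h.2.1
  obtain ⟨x, hx⟩ := Ev.exists (C := C) hp h1
  obtain ⟨y, hy⟩ := Ev.exists (C := C) hq h2
  have hc := (hx.join_iff hy).1 h.2.1
  exact ⟨x, y, hx, hy, hc, h.unique (hx.mul hy hc)⟩

theorem id_loop (hcat : IsSmallCategory S.toPreSgpd) {e : A} (he : IsIdentity S.toPreSgpd e) :
    S.src e = S.tgt e := by
  obtain ⟨f, h1, h2, h3⟩ := hcat (S.tgt e)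
  have h4 := he.1 f h1.symm
  have h5 := h3.2 e h1.symm
  rw [h4] at h5
  rw [← h5, h1, h2]

theorem Ev.id (hcat : IsSmallCategory S.toPreSgpd) {c : List E} {y : A} (h : Ev C c y)
    (hc : ∀ e ∈ c, IsIdentity S.toPreSgpd (C.lab e)) : IsIdentity S.toPreSgpd y := by
  induction c generalizing y with
  | nil => exact absurd rfl h.1
  | cons e c ih =>
    rcases eq_or_ne c [] with rfl | hne
    · rw [h.unique (Ev.single e)]; exact hc e (by simp)
    · obtain ⟨x, z, hx, hz, h1, rfl⟩ := Ev.split (p := [e]) (by simp) hne h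
      have he := hc e (by simp)
      rw [hx.unique (Ev.single e)] at h1 ⊢
      rw [he.1 _ h1]
      exact ih hz (fun e he => hc e (by simp [he]))

theorem Ev.remove (hcat : IsSmallCategory S.toPreSgpd) {p c r : List E} {z : A}
    (h : Ev C (p ++ c ++ r) z) (hc : ∀ e ∈ c, IsIdentity S.toPreSgpd (C.lab e))
    (hne : p ++ r ≠ []) : Ev C (p ++ r) z := by
  rcases eq_or_ne c [] with rfl | hcn
  · simpa using h
  rcases eq_or_ne p [] with rfl | hp
  · have hr : r ≠ [] := by simpa using hne
    simp only [List.nil_append] at h ⊢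
    obtain ⟨x, y, hx, hy, h1, rfl⟩ := Ev.split hcn hr h
    rw [(hx.id hcat hc).1 _ h1]; exact hy
  rcases eq_or_ne r [] with rfl | hr
  · simp only [List.append_nil] at h ⊢
    obtain ⟨x, y, hx, hy, h1, rfl⟩ := Ev.split hp hcn h
    rw [(hy.id hcat hc).2 _ h1]; exact hx
  obtain ⟨x, y, hx, hy, h1, rfl⟩ := Ev.split (by simp [hp]) hr h
  obtain ⟨x', y', hx', hy', h1', rfl⟩ := Ev.split hp hcn hx
  have hi := hy'.id hcat hc
  rw [hi.2 _ h1'] at h1 ⊢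
  exact hx'.mul hy h1

theorem pump (hcat : IsSmallCategory S.toPreSgpd) (hK : IsRegularSet C.K) :
    ∃ N, 1 ≤ N ∧ ∀ a, ∃ u ∈ C.K, Ev C u a ∧ ∀ p c r, u = p ++ c ++ r → c.length = N →
      ∃ e ∈ c, ¬ IsIdentity S.toPreSgpd (C.lab e) := by
  obtain ⟨Q, hQ, step, s, acc, hL⟩ := reg_dfa hK
  refine ⟨Nat.card Q + 1, by omega, fun a => ?_⟩
  classical
  have hex : ∃ n, ∃ u ∈ C.K, Ev C u a ∧ u.length = n := by
    obtain ⟨u, hu, h⟩ := Ev.onto C a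
    exact ⟨_, u, hu, h, rfl⟩
  obtain ⟨u, hu, hev, hlen⟩ := Nat.find_spec hex
  refine ⟨u, hu, hev, ?_⟩
  rintro p c r rfl hc
  by_contra! hid
  have hpig : ∃ i j : Fin (Nat.card Q + 1), i ≠ j ∧
      (p ++ c.take i).foldl step s = (p ++ c.take j).foldl step s := by
    by_contra! hcon
    have hinj : Function.Injective (fun i : Fin (Nat.card Q + 1) =>
      (p ++ c.take i).foldl step s) := by
      intro i j hij
      by_contra hne
      exact hcon i j hne hij
    have := Nat.card_le_card_of_injective _ hinj
    simp at this
  obtain ⟨i, j, hij, heq⟩ : ∃ i j : ℕ, (i < j ∧ j < Nat.card Q + 1) ∧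
      (p ++ c.take i).foldl step s = (p ++ c.take j).foldl step s := by
    obtain ⟨i, j, hij, heq⟩ := hpig
    rcases lt_or_gt_of_ne hij with h | h
    · exact ⟨i, j, ⟨h, j.2⟩, heq⟩
    · exact ⟨j, i, ⟨h, i.2⟩, heq.symm⟩
  have hmem : (p ++ c.take i) ++ (c.drop j ++ r) ∈ C.K := by
    have h1 : p ++ c ++ r = (p ++ c.take j) ++ (c.drop j ++ r) := by
      simp only [List.append_assoc]
      rw [← List.append_assoc (c.take j), List.take_append_drop]
    rw [h1, hL, List.foldl_append] at hu
    rwa [hL, List.foldl_append, heq]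
  have hdec : p ++ c ++ r = (p ++ c.take i) ++ (c.drop i).take (j - i) ++ (c.drop j ++ r) := by
    have : c = c.take i ++ ((c.drop i).take (j - i) ++ c.drop j) := by
      conv_lhs => rw [← List.take_append_drop i c, ← List.take_append_drop (j - i) (c.drop i)]
      rw [List.drop_drop]
      congr 3; omega
    conv_lhs => rw [this]
    simp only [List.append_assoc]
  rw [hdec] at hev
  have h2 := hev.remove hcat (fun e he => hid e (List.mem_of_mem_drop (List.mem_of_mem_take he)))
    (C.K_path _ hmem).1
  refine Nat.find_min hex (m := ((p ++ c.take i) ++ (c.drop j ++ r)).length) ?_ ⟨_, hmem, h2, rfl⟩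
  rw [← hlen]
  simp only [List.length_append, List.length_take, List.length_drop]
  omega

/-- The relation of right multiplication by the arrow `s`. -/
def relS (C : ChoiceOfReps S.toPreSgpd E) (s : A) : Set (List E × List E) :=
  {p | p.1 ∈ C.K ∧ p.2 ∈ C.K ∧ ∃ x, Ev C p.1 x ∧ S.tgt x = S.src s ∧ Ev C p.2 (S.mul x s)}

theorem relS_edge (e : E) : relS C (C.lab e) = relEdge C e := by
  ext ⟨u, v⟩
  constructor
  · rintro ⟨hu, hv, x, hx, h1, h2⟩
    refine ⟨hu, hv, ?_, ?_⟩
    · rw [hx.ends.2, h1, C.lab_src]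
    · exact (eval_snoc _ _ e hx.2.2).trans h2.2.2.symm
  · rintro ⟨hu, hv, h1, h2⟩
    obtain ⟨x, hx⟩ := Ev.ofK hu
    refine ⟨hu, hv, x, hx, ?_, ?_⟩
    · rw [hx.ends.2] at h1
      rw [C.lab_src]; simpa using h1
    · refine ⟨(C.K_path _ hv).1, (C.K_path _ hv).2, ?_⟩
      rw [← eval_snoc _ _ e hx.2.2]; exact h2.symm

theorem relS_mul {s t : A} (h : S.tgt s = S.src t) :
    relS C (S.mul s t) = {p | ∃ z, (p.1, z) ∈ relS C s ∧ (z, p.2) ∈ relS C t} := by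
  ext ⟨u, v⟩
  constructor
  · rintro ⟨hu, hv, x, hx, h1, h2⟩
    rw [S.src_mul _ _ h] at h1
    obtain ⟨z, hz, hz'⟩ := Ev.onto C (S.mul x s)
    refine ⟨z, ⟨hu, hz, x, hx, h1, hz'⟩, ⟨hz, hv, _, hz', ?_, ?_⟩⟩
    · rw [S.tgt_mul _ _ h1, h]
    · rw [S.mul_assoc' _ _ _ h1 h]; exact h2
  · rintro ⟨z, ⟨hu, hz, x, hx, h1, h2⟩, ⟨-, hv, y, hy, h3, h4⟩⟩
    have := hy.unique h2
    subst this
    refine ⟨hu, hv, x, hx, ?_, ?_⟩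
    · rw [S.src_mul _ _ h]; exact h1
    · rw [← S.mul_assoc' _ _ _ h1 h]; exact h4

theorem relS_mach [Finite E] (h : ∀ a : E, SyncRegular C.etgt (relEdge C a)) (s : A) :
    Mach (relS C s) := by
  obtain ⟨u, -, hu⟩ := Ev.onto C s
  induction u using List.reverseRecOn generalizing s with
  | nil => exact absurd rfl hu.1
  | append_singleton u e ih =>
    have he : Mach (relS C (C.lab e)) := by
      rw [relS_edge]; exact mach_of_sync _ (h e)
    rcases eq_or_ne u [] with rfl | hne
    · rw [hu.unique (Ev.single e)]; exact he
    · obtain ⟨x, y, hx, hy, h1, rfl⟩ := Ev.split hne (by simp) hu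
      obtain rfl := hy.unique (Ev.single e)
      rw [relS_mul h1]
      exact (ih x hx).comp he

theorem finite_obj [Finite E] (hcat : IsSmallCategory S.toPreSgpd)
    (C : ChoiceOfReps S.toPreSgpd E) : Finite O := by
  refine Finite.of_surjective C.etgt fun v => ?_
  obtain ⟨e, h1, h2, -⟩ := hcat v
  obtain ⟨u, -, hu⟩ := Ev.onto C e
  have := hu.ends.2
  rw [h2] at this
  simp only [pathTgt?, Option.map_eq_some_iff] at this
  obtain ⟨l, -, h⟩ := this
  exact ⟨l, h⟩

theorem relEq_mach [Finite E] [Finite O] (h : ∀ v : O, SyncRegular C.etgt (relVertex C v)) :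
    Mach (relEq C) := by
  have : relEq C = ⋃ v, relVertex C v := by
    ext ⟨u, v⟩
    rw [Set.mem_iUnion]
    constructor
    · rintro ⟨h1, h2, h3⟩
      obtain ⟨x, hx⟩ := Ev.ofK h1
      exact ⟨_, h1, h2, hx.ends.2, h3⟩
    · rintro ⟨_, h1, h2, _, h3⟩
      exact ⟨h1, h2, h3⟩
  rw [this]
  exact Mach.iUnion fun v => mach_of_sync _ (h v)

end

namespace Rees

theorem mul0_eq {O A I Λ : Type} {S : Sgpd O A} {R : Data0 S I Λ}
    {i j : I} {x y : A} {lam mu : Λ} (hx : Valid S R.F R.G (i, x, lam))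
    (hy : Valid S R.F R.G (j, y, mu)) :
    mul0 S R (some ⟨(i, x, lam), hx⟩) (some ⟨(j, y, mu), hy⟩) =
    (match hp : R.P lam j with
    | some p => some ⟨(i, S.mul (S.mul x p) y, mu),
        prod_valid S hx hy (R.P_src lam j p hp) (R.P_tgt lam j p hp)⟩
    | none => none) := rfl

theorem mul0_left {O A I Λ : Type} {S : Sgpd O A} {R : Data0 S I Λ} {a b : Carrier0 S R}
    {t : Triples S R.F R.G} (h : mul0 S R a b = some t) :
    ∃ t', a = some t' ∧ t'.1.1 = t.1.1 := by
  match a, b with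
  | some ⟨(i, x, lam), hx⟩, some ⟨(j, y, mu), hy⟩ =>
    rw [mul0_eq] at h
    split at h
    · obtain rfl := Option.some.inj h
      exact ⟨_, rfl, rfl⟩
    · cases h
  | none, none => cases h
  | none, some _ => cases h
  | some _, none => cases h

theorem mul0_right {O A I Λ : Type} {S : Sgpd O A} {R : Data0 S I Λ} {a b : Carrier0 S R}
    {t : Triples S R.F R.G} (h : mul0 S R a b = some t) :
    ∃ t', b = some t' ∧ t'.1.2.2 = t.1.2.2 := by
  match a, b with
  | some ⟨(i, x, lam), hx⟩, some ⟨(j, y, mu), hy⟩ =>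
    rw [mul0_eq] at h
    split at h
    · obtain rfl := Option.some.inj h
      exact ⟨_, rfl, rfl⟩
    · cases h
  | none, none => cases h
  | none, some _ => cases h
  | some _, none => cases h

theorem mul0_some {O A I Λ : Type} {S : Sgpd O A} {R : Data0 S I Λ}
    {i j : I} {x y p : A} {lam mu : Λ} (hx : Valid S R.F R.G (i, x, lam))
    (hy : Valid S R.F R.G (j, y, mu)) (hp : R.P lam j = some p) :
    ∃ hv, mul0 S R (some ⟨(i, x, lam), hx⟩) (some ⟨(j, y, mu), hy⟩)
      = some ⟨(i, S.mul (S.mul x p) y, mu), hv⟩ := by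
  refine ⟨prod_valid S hx hy (R.P_src lam j p hp) (R.P_tgt lam j p hp), ?_⟩
  rw [mul0_eq]
  split
  · next q hq =>
    have : q = p := by rw [hp] at hq; exact (Option.some.inj hq).symm
    subst this; rfl
  · next hq => rw [hp] at hq; cases hq

theorem mul0_zero {O A I Λ : Type} {S : Sgpd O A} {R : Data0 S I Λ}
    {i j : I} {x y : A} {lam mu : Λ} (hx : Valid S R.F R.G (i, x, lam))
    (hy : Valid S R.F R.G (j, y, mu)) (hp : R.P lam j = none) :
    mul0 S R (some ⟨(i, x, lam), hx⟩) (some ⟨(j, y, mu), hy⟩) = none := by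
  rw [mul0_eq]
  split
  · next q hq => rw [hp] at hq; cases hq
  · rfl

theorem finite_I {O A I Λ : Type} {S : Sgpd O A} {R : Data0 S I Λ} (h : IsFG (pre0 S R)) :
    Finite I ∧ Finite Λ := by
  obtain ⟨T, hT, h⟩ := h
  have hl : ∀ (l : List (Carrier0 S R)) (a : Carrier0 S R) t,
      l.foldl (mul0 S R) a = some t → ∃ t', a = some t' ∧ t'.1.1 = t.1.1 := by
    intro l
    induction l with
    | nil => intro a t h; exact ⟨t, h, rfl⟩
    | cons b l ih =>
      intro a t h
      obtain ⟨t1, h1, h2⟩ := ih _ _ h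
      obtain ⟨t2, h3, h4⟩ := mul0_left h1
      exact ⟨t2, h3, h4.trans h2⟩
  constructor
  · have : Set.univ ⊆ (some : I → Option I) ⁻¹'
      ((fun m : Carrier0 S R => Option.map (fun t : Triples S R.F R.G => t.1.1) m) '' T) := by
      intro i _
      obtain ⟨a, ha⟩ := R.F_into i
      obtain ⟨lam, hlam⟩ := R.G_onto a
      obtain ⟨l, h1, h2, h3, h4⟩ := h (some ⟨(i, a, lam), ha.symm, hlam.symm⟩)
      cases l with
      | nil => exact absurd rfl h1
      | cons b l =>
        simp only [evalPath?, List.map_id, Option.some.injEq] at h4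
        obtain ⟨t', h5, h6⟩ := hl _ _ _ (Option.some.inj h4)
        refine ⟨b, h2 b (by simp), ?_⟩
        have : b = some t' := h5
        rw [this]
        exact congrArg some h6
    have hfin := ((hT.image _).preimage (Option.some_injective I).injOn).subset this
    exact Set.finite_univ_iff.1 hfin
  · have : Set.univ ⊆ (some : Λ → Option Λ) ⁻¹'
      ((fun m : Carrier0 S R => Option.map (fun t : Triples S R.F R.G => t.1.2.2) m) '' T) := by
      intro lam _
      obtain ⟨a, ha⟩ := R.G_into lam
      obtain ⟨i, hi⟩ := R.F_onto a
      obtain ⟨l, h1, h2, h3, h4⟩ := h (some ⟨(i, a, lam), hi, ha⟩)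
      rcases List.eq_nil_or_concat l with rfl | ⟨l, b, rfl⟩
      · exact absurd rfl h1
      · rw [List.concat_eq_append] at h2 h4
        have hb : ∃ t', b = some t' ∧ t'.1.2.2 = lam := by
          cases l with
          | nil =>
            simp only [List.nil_append, evalPath?, List.map_nil, List.foldl_nil,
              Option.some.injEq] at h4
            exact ⟨_, Option.some.inj h4, rfl⟩
          | cons c l =>
            have := eval_snoc (pre0 S R) id (u := c :: l) b rfl
            rw [this] at h4
            exact mul0_right (Option.some.inj h4)
        obtain ⟨t', h5, h6⟩ := hb
        refine ⟨b, h2 b (by simp), ?_⟩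
        rw [h5]
        exact congrArg some h6
    have hfin := ((hT.image _).preimage (Option.some_injective Λ).injOn).subset this
    exact Set.finite_univ_iff.1 hfin

end Rees


/-! ### The alphabet and the language for the Rees matrix semigroup -/

theorem reg_inter {α : Type} {L L' : Set (List α)} (h : IsRegularSet L) (h' : IsRegularSet L') :
    IsRegularSet (L ∩ L') :=
  ((Mach.left (β := α) h).inter (Mach.left (β := α) h')).diag

theorem reg_iUnion {α ι : Type} [Finite ι] {L : ι → Set (List α)}
    (h : ∀ i, IsRegularSet (L i)) : IsRegularSet (⋃ i, L i) := by
  have := (Mach.iUnion (fun i => Mach.left (β := α) (h i))).diag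
  convert this using 1
  ext u
  simp only [Set.mem_iUnion]
  rfl

/-- The alphabet: `none` is the zero letter. -/
abbrev Ltr (E I Λ : Type) (N : ℕ) : Type :=
  Option (Option I × {c : List E // c.length ≤ 2 * N} × Option Λ)

/-- The content of a letter. -/
def cont {E I Λ : Type} {N : ℕ} : Ltr E I Λ N → List E
  | none => []
  | some l => l.2.1.1

/-- The index in `Λ` of a letter. -/
def lamOf {E I Λ : Type} {N : ℕ} : Ltr E I Λ N → Option Λ
  | none => none
  | some l => l.2.2

/-- The index in `I` of a letter. -/
def iOf {E I Λ : Type} {N : ℕ} : Ltr E I Λ N → Option I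
  | none => none
  | some l => l.1

theorem finite_ltr {E I Λ : Type} (N : ℕ) [Finite E] [Finite I] [Finite Λ] :
    Finite (Ltr E I Λ N) := by
  have : Finite {c : List E // c.length ≤ 2 * N} := (List.finite_length_le E (2 * N)).to_subtype
  unfold Ltr
  infer_instance

theorem cont_length {E I Λ : Type} {N : ℕ} (l : Ltr E I Λ N) : (cont l).length ≤ 2 * N := by
  cases l with
  | none => simp [cont]
  | some l => exact l.2.1.2

section
variable {O A E I Λ : Type} {S : Sgpd O A} {C : ChoiceOfReps S.toPreSgpd E}
  {R : Rees.Data0 S I Λ} {N : ℕ} {lamP : O → Λ}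

/-- Having a non-identity edge. -/
def NonId (C : ChoiceOfReps S.toPreSgpd E) (c : List E) : Prop :=
  ∃ e ∈ c, ¬ IsIdentity S.toPreSgpd (C.lab e)

/-- Right-ideal generation with respect to the cross-section `lamP`. -/
def Gen (R : Rees.Data0 S I Λ) (lamP : O → Λ) (x : A) : Prop :=
  ∃ j p s, R.P (lamP (S.src x)) j = some p ∧ S.tgt p = S.src s ∧ x = S.mul p s

theorem Gen.of_nonId (hr : ∀ x, ¬ IsIdentity S.toPreSgpd x → Gen R lamP x) {c : List E} {x : A}
    (h : Ev C c x) (hc : NonId C c) : Gen R lamP x := by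
  induction c generalizing x with
  | nil => exact absurd rfl h.1
  | cons e c ih =>
    rcases eq_or_ne c [] with rfl | hne
    · obtain ⟨f, hf, hn⟩ := hc
      obtain rfl : f = e := by simpa using hf
      rw [h.unique (Ev.single f)]
      exact hr _ hn
    · obtain ⟨a, y, ha, hy, h1, rfl⟩ := Ev.split (p := [e]) (by simp) hne h
      obtain rfl := ha.unique (Ev.single e)
      by_cases hid : IsIdentity S.toPreSgpd (C.lab e)
      · rw [hid.1 _ h1]
        refine ih hy ?_
        obtain ⟨f, hf, hn⟩ := hc
        rcases List.mem_cons.1 hf with rfl | hf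
        · exact absurd hid hn
        · exact ⟨f, hf, hn⟩
      · obtain ⟨j, p, s, h2, h3, h4⟩ := hr _ hid
        refine ⟨j, p, S.mul s y, ?_, ?_, ?_⟩
        · rw [S.src_mul _ _ h1]; exact h2
        · rw [S.src_mul _ _ ?_]
          · exact h3
          · rw [← h1, h4, S.tgt_mul _ _ h3]
        · conv_lhs => rw [h4]
          rw [S.mul_assoc' _ _ _ h3]
          rw [← h1, h4, S.tgt_mul _ _ h3]

/-- Specification of the labelling of the new alphabet. -/
def LabSpec (C : ChoiceOfReps S.toPreSgpd E) (R : Rees.Data0 S I Λ) (N : ℕ) (lamP : O → Λ)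
    (l : Ltr E I Λ N) (m : Rees.Carrier0 S R) : Prop :=
  (l = none → m = none) ∧
  (∀ i c o x, l = some (some i, c, o) → Ev C c.1 x →
    ∀ hv : Rees.Valid S R.F R.G (i, x, o.getD (lamP (S.tgt x))), m = some ⟨_, hv⟩) ∧
  (∀ c o x, l = some (none, c, o) → Ev C c.1 x → NonId C c.1 →
    S.tgt x = R.G (o.getD (lamP (S.tgt x))) →
    ∃ j p s, ∃ hv : Rees.Valid S R.F R.G (j, s, o.getD (lamP (S.tgt x))),
      R.P (lamP (S.src x)) j = some p ∧ S.tgt p = S.src s ∧ x = S.mul p s ∧ m = some ⟨_, hv⟩)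

theorem labSpec_exists (hr : ∀ x, ¬ IsIdentity S.toPreSgpd x → Gen R lamP x)
    (l : Ltr E I Λ N) : ∃ m, LabSpec C R N lamP l m := by
  match l with
  | none =>
    refine ⟨none, fun _ => rfl, ?_, ?_⟩
    · intro i c o x h; cases h
    · intro c o x h; cases h
  | some (some i, c, o) =>
    by_cases h : ∃ x, Ev C c.1 x ∧ Rees.Valid S R.F R.G (i, x, o.getD (lamP (S.tgt x)))
    · obtain ⟨x, hx, hv⟩ := h
      refine ⟨some ⟨_, hv⟩, fun h => (by cases h), ?_, fun _ _ _ h => (by cases h)⟩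
      intro i' c' o' x' h hx' hv'
      cases h
      obtain rfl := hx.unique hx'
      rfl
    · refine ⟨none, fun h => (by cases h), ?_, fun _ _ _ h => (by cases h)⟩
      intro i' c' o' x' h' hx' hv'
      cases h'
      exact absurd ⟨x', hx', hv'⟩ h
  | some (none, c, o) =>
    by_cases h : ∃ x, Ev C c.1 x ∧ NonId C c.1 ∧ S.tgt x = R.G (o.getD (lamP (S.tgt x)))
    · obtain ⟨x, hx, hn, hG⟩ := h
      obtain ⟨j, p, s, h1, h2, h3⟩ := Gen.of_nonId hr hx hn
      have hv : Rees.Valid S R.F R.G (j, s, o.getD (lamP (S.tgt x))) := by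
        refine ⟨?_, ?_⟩
        · show R.F j = S.src s
          rw [← h2, R.P_tgt _ _ _ h1]
        · show S.tgt s = R.G _
          rw [← hG, h3, S.tgt_mul _ _ h2]
      refine ⟨some ⟨_, hv⟩, fun h => (by cases h), fun _ _ _ _ h => (by cases h), ?_⟩
      intro c' o' x' h' hx' _ _
      cases h'
      obtain rfl := hx.unique hx'
      exact ⟨j, p, s, hv, h1, h2, h3, rfl⟩
    · refine ⟨none, fun h => (by cases h), fun _ _ _ _ h => (by cases h), ?_⟩
      intro c' o' x' h' hx' h1 h2
      cases h'
      exact absurd ⟨x', hx', h1, h2⟩ h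

/-- Shaped words. -/
def Sh (C : ChoiceOfReps S.toPreSgpd E) (N : ℕ) (i : I) (o : Option Λ) (w : List (Ltr E I Λ N)) :
    Prop :=
  (∃ l, w.head? = some l ∧ iOf l = some i) ∧
  (∀ l ∈ w.tail, (∃ c o, l = some (none, c, o)) ∧ NonId C (cont l)) ∧
  (∀ l ∈ w.dropLast, (cont l).length = N ∧ lamOf l = none) ∧
  (∃ l, w.getLast? = some l ∧ lamOf l = o)

theorem reg_Sh (i : I) (o : Option Λ) : IsRegularSet {w | Sh C N i o w} :=
  reg_inter (reg_head _) (reg_inter (reg_tail _) (reg_inter (reg_dropLast _) (reg_last _)))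

theorem Sh.ne {i : I} {o : Option Λ} {w : List (Ltr E I Λ N)} (h : Sh C N i o w) : w ≠ [] := by
  rintro rfl
  obtain ⟨⟨l, h, -⟩, -⟩ := h
  simp at h

theorem Sh.ne_zero {i : I} {o : Option Λ} {w : List (Ltr E I Λ N)} (h : Sh C N i o w) :
    w ≠ [none] := by
  rintro rfl
  obtain ⟨⟨l, h, h'⟩, -⟩ := h
  simp at h
  subst h
  simp [iOf] at h'

theorem Sh.uniq {i i' : I} {o o' : Option Λ} {w : List (Ltr E I Λ N)} (h : Sh C N i o w)
    (h' : Sh C N i' o' w) : i = i' ∧ o = o' := by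
  obtain ⟨⟨l, h1, h2⟩, -, -, m, h3, h4⟩ := h
  obtain ⟨⟨l', h1', h2'⟩, -, -, m', h3', h4'⟩ := h'
  rw [h1] at h1'
  rw [h3] at h3'
  cases h1'
  cases h3'
  rw [h2] at h2'
  rw [h4] at h4'
  exact ⟨Option.some.inj h2', h4'⟩

theorem Sh.initSeg {i : I} {o : Option Λ} {v t : List (Ltr E I Λ N)} (h : Sh C N i o (v ++ t))
    (hv : v ≠ []) (ht : t ≠ []) :
    Sh C N i none v ∧ (∀ l ∈ v, (cont l).length = N) ∧
      (∀ l ∈ t, (∃ c o, l = some (none, c, o)) ∧ NonId C (cont l)) ∧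
      (∃ l, t.getLast? = some l ∧ lamOf l = o) := by
  obtain ⟨h1, h2, h3, h4⟩ := h
  rw [List.dropLast_append_of_ne_nil ht] at h3
  rw [List.tail_append_of_ne_nil hv] at h2
  have h3' : ∀ l ∈ v, (cont l).length = N ∧ lamOf l = none := fun l hl => h3 l (by simp [hl])
  refine ⟨⟨?_, fun l hl => h2 l (by simp [hl]), fun l hl => h3' l (List.dropLast_subset _ hl), ?_⟩,
    fun l hl => (h3' l hl).1, fun l hl => h2 l (by simp [hl]), ?_⟩
  · rwa [List.head?_append_of_ne_nil _ hv] at h1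
  · exact ⟨_, List.getLast?_eq_some_getLast hv, (h3' _ (List.getLast_mem hv)).2⟩
  · rwa [List.getLast?_append_of_ne_nil _ ht] at h4

theorem content_ne {w : List (Ltr E I Λ N)} (hw : w ≠ []) (hN : 1 ≤ N)
    (h : ∀ l ∈ w, (cont l).length = N) : w.flatMap cont ≠ [] := by
  cases w with
  | nil => exact absurd rfl hw
  | cons a w =>
    have := h a (by simp)
    intro h0
    simp only [List.flatMap_cons, List.append_eq_nil_iff] at h0
    rw [h0.1] at this
    simp at this
    omega

theorem value (hN : 1 ≤ N) (hG : ∀ v, R.G (lamP v) = v) {lab : Ltr E I Λ N → Rees.Carrier0 S R}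
    (hlab : ∀ l, LabSpec C R N lamP l (lab l)) {w : List (Ltr E I Λ N)} {i : I} {o : Option Λ}
    {x : A} (h : Sh C N i o w) (hx : Ev C (w.flatMap cont) x)
    (hv : Rees.Valid S R.F R.G (i, x, o.getD (lamP (S.tgt x)))) :
    evalPath? (Rees.pre0 S R) lab w = some (some ⟨_, hv⟩) := by
  induction w using List.reverseRecOn generalizing o x with
  | nil => exact absurd rfl h.ne
  | append_singleton w l ih =>
    rcases eq_or_ne w [] with rfl | hne
    · obtain ⟨⟨l', h1, h2⟩, -, -, m, h3, h4⟩ := h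
      simp at h1 h3
      subst h1 h3
      match l with
      | none => simp [iOf] at h2
      | some (i', c, o') =>
        obtain rfl : i' = some i := h2
        obtain rfl : o' = o := h4
        have hx' : Ev C c.1 x := by simpa [cont] using hx
        exact congrArg some ((hlab _).2.1 i c o' x rfl hx' hv)
    · obtain ⟨h1, h2, h3, m, h4, h5⟩ := h.initSeg hne (by simp)
      simp at h4
      subst h4
      obtain ⟨⟨c, o', rfl⟩, hnid⟩ := h3 l (by simp)
      obtain rfl : o' = o := h5
      rw [List.flatMap_append] at hx
      have hx0 : Ev C (w.flatMap cont ++ c.1) x := by simpa [cont] using hx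
      obtain ⟨x1, x2, hx1, hx2, hc, rfl⟩ := Ev.split (content_ne hne hN h2)
        (by rintro h0; obtain ⟨e, he, -⟩ := hnid; simp [cont, h0] at he) hx0
      have hv1 : Rees.Valid S R.F R.G (i, x1, (none : Option Λ).getD (lamP (S.tgt x1))) := by
        refine ⟨?_, ?_⟩
        · show R.F i = S.src x1
          rw [← S.src_mul _ _ hc]; exact hv.1
        · show S.tgt x1 = R.G (lamP (S.tgt x1))
          rw [hG]
      have ih' := ih h1 hx1 hv1
      rw [eval_snoc _ _ _ ih']
      have hv2 := hv.2
      change S.tgt (S.mul x1 x2) = R.G (o'.getD (lamP (S.tgt (S.mul x1 x2)))) at hv2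
      have htg := S.tgt_mul _ _ hc
      obtain ⟨j, p, s, hvs, e1, e2, e3, e4⟩ := (hlab (some (none, c, o'))).2.2 c o' x2 rfl hx2 hnid
        (by rw [htg] at hv2; exact hv2)
      rw [e4]
      have e1' : R.P ((none : Option Λ).getD (lamP (S.tgt x1))) j = some p := by
        rw [← hc] at e1; exact e1
      obtain ⟨hvf, e5⟩ := Rees.mul0_some hv1 hvs e1'
      refine congrArg some (e5.trans ?_)
      have e6 : S.mul (S.mul x1 p) s = S.mul x1 x2 := by
        rw [e3, S.mul_assoc' _ _ _ _ e2]
        rw [R.P_src _ _ _ e1, hG, hc]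
      refine congrArg some (Subtype.ext ?_)
      show (i, S.mul (S.mul x1 p) s, o'.getD (lamP (S.tgt x2))) =
        (i, S.mul x1 x2, o'.getD (lamP (S.tgt (S.mul x1 x2))))
      rw [e6, htg]

/-- The pieces of the language of representatives. -/
def Gd (C : ChoiceOfReps S.toPreSgpd E) (R : Rees.Data0 S I Λ) (N : ℕ) (i : I) (lam : Λ)
    (w : List (Ltr E I Λ N)) : Prop :=
  Sh C N i (some lam) w ∧ w.flatMap cont ∈ C.K ∧
    pathSrc? C.esrc (w.flatMap cont) = some (R.F i) ∧
    pathTgt? C.etgt (w.flatMap cont) = some (R.G lam)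

theorem Gd.value (hN : 1 ≤ N) (hG : ∀ v, R.G (lamP v) = v)
    {lab : Ltr E I Λ N → Rees.Carrier0 S R}
    (hlab : ∀ l, LabSpec C R N lamP l (lab l)) {w : List (Ltr E I Λ N)} {i : I} {lam : Λ}
    (h : Gd C R N i lam w) : ∃ x, ∃ hv : Rees.Valid S R.F R.G (i, x, lam),
      Ev C (w.flatMap cont) x ∧ evalPath? (Rees.pre0 S R) lab w = some (some ⟨_, hv⟩) := by
  obtain ⟨h1, h2, h3, h4⟩ := h
  obtain ⟨x, hx⟩ := Ev.ofK h2
  rw [hx.ends.1] at h3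
  rw [hx.ends.2] at h4
  have hv : Rees.Valid S R.F R.G (i, x, lam) := ⟨(Option.some.inj h3).symm, Option.some.inj h4⟩
  exact ⟨x, hv, hx, AutoRees.value hN hG hlab h1 hx hv⟩

theorem tail_chunk (hN : 1 ≤ N) (lam : Λ) (u : List E) (hl : N ≤ u.length)
    (hu : ∀ p c r, u = p ++ c ++ r → c.length = N → NonId C c) :
    ∃ w : List (Ltr E I Λ N), w ≠ [] ∧ w.flatMap cont = u ∧
      (∀ l ∈ w, (∃ c o, l = some (none, c, o)) ∧ NonId C (cont l)) ∧
      (∀ l ∈ w.dropLast, (cont l).length = N ∧ lamOf l = none) ∧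
      (∃ l, w.getLast? = some l ∧ lamOf l = some lam) := by
  induction hn : u.length using Nat.strong_induction_on generalizing u with
  | _ n ih =>
    have hmono : ∀ a b c : List E, NonId C b → NonId C (a ++ b ++ c) := by
      rintro a b c ⟨e, he, h⟩
      exact ⟨e, by simp [he], h⟩
    have htake : NonId C (u.take N) :=
      hu [] (u.take N) (u.drop N) (by simp) (by simp; omega)
    by_cases h2 : u.length ≤ 2 * N
    · refine ⟨[some (none, ⟨u, h2⟩, some lam)], by simp, by simp [cont], ?_, by simp, ?_⟩
      · intro l hl
        obtain rfl := List.mem_singleton.1 hl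
        refine ⟨⟨_, _, rfl⟩, ?_⟩
        have := hmono [] (u.take N) (u.drop N) htake
        simpa [cont] using this
      · exact ⟨_, rfl, rfl⟩
    · obtain ⟨w, w1, w2, w3, w4, w5⟩ := ih (u.drop N).length (by simp; omega) (u.drop N)
        (by simp; omega) (by
          intro p c r h hc
          refine hu (u.take N ++ p) c r ?_ hc
          rw [← List.take_append_drop N u]
          conv_lhs => rw [h]
          simp) rfl
      refine ⟨some (none, ⟨u.take N, by simp; omega⟩, none) :: w, by simp, ?_, ?_, ?_, ?_⟩
      · simp [cont, w2]
      · intro l hl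
        rcases List.mem_cons.1 hl with rfl | hl
        · exact ⟨⟨_, _, rfl⟩, htake⟩
        · exact w3 l hl
      · rw [List.dropLast_cons_of_ne_nil w1]
        intro l hl
        rcases List.mem_cons.1 hl with rfl | hl
        · exact ⟨by simp [cont]; omega, rfl⟩
        · exact w4 l hl
      · rwa [List.getLast?_cons_of_ne_nil w1]

theorem chunk (hN : 1 ≤ N) (i : I) (lam : Λ) (u : List E)
    (hu : ∀ p c r, u = p ++ c ++ r → c.length = N → NonId C c) :
    ∃ w : List (Ltr E I Λ N), Sh C N i (some lam) w ∧ w.flatMap cont = u := by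
  by_cases h2 : u.length ≤ 2 * N
  · refine ⟨[some (some i, ⟨u, h2⟩, some lam)], ⟨⟨_, rfl, rfl⟩, by simp, by simp, ⟨_, rfl, rfl⟩⟩, ?_⟩
    simp [cont]
  · obtain ⟨w, w1, w2, w3, w4, w5⟩ := tail_chunk (I := I) hN lam (u.drop N) (by simp; omega) (by
        intro p c r h hc
        refine hu (u.take N ++ p) c r ?_ hc
        rw [← List.take_append_drop N u]
        conv_lhs => rw [h]
        simp)
    refine ⟨some (some i, ⟨u.take N, by simp; omega⟩, none) :: w,
      ⟨⟨_, rfl, rfl⟩, w3, ?_, ?_⟩, ?_⟩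
    · rw [List.dropLast_cons_of_ne_nil w1]
      intro l hl
      rcases List.mem_cons.1 hl with rfl | hl
      · exact ⟨by simp [cont]; omega, rfl⟩
      · exact w4 l hl
    · rwa [List.getLast?_cons_of_ne_nil w1]
    · simp [cont, w2]

/-- Words for which `Mach.pull` applies. -/
def Dr (N : ℕ) : Set (List (Ltr E I Λ N)) := {w | ∀ l ∈ w.dropLast, (cont l).length = N}

theorem mach_pieces [Finite E] {ι ι' : Type} [Finite ι] [Finite ι']
    {L : ι → Set (List (Ltr E I Λ N))} {L' : ι' → Set (List (Ltr E I Λ N))}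
    (hL : ∀ k, IsRegularSet (L k)) (hL' : ∀ k, IsRegularSet (L' k))
    (hD : ∀ k, L k ⊆ Dr N) (hD' : ∀ k, L' k ⊆ Dr N)
    {T : Set (List (Ltr E I Λ N) × List (Ltr E I Λ N))}
    (hT : ∀ u v, (u, v) ∈ T → (∃ k, u ∈ L k) ∧ ∃ k, v ∈ L' k)
    (h : ∀ k k', ∃ W : Set (List E × List E), Mach W ∧ ∀ u ∈ L k, ∀ v ∈ L' k',
      ((u, v) ∈ T ↔ (u.flatMap cont, v.flatMap cont) ∈ W)) : Mach T := by
  choose W hW hWT using h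
  have key : T = ⋃ k, ⋃ k', ({p : List (Ltr E I Λ N) × List (Ltr E I Λ N) | p.1 ∈ L k} ∩
      {p | p.2 ∈ L' k'}) ∩ ((({p : List (Ltr E I Λ N) × List (Ltr E I Λ N) |
        p.1 ∈ {w : List (Ltr E I Λ N) | ∀ l ∈ w.dropLast, (cont l).length = N}} ∩
      {p | p.2 ∈ {w : List (Ltr E I Λ N) | ∀ l ∈ w.dropLast, (cont l).length = N}}) ∩
      {p | (p.1.flatMap cont, p.2.flatMap cont) ∈ W k k'})) := by
    ext ⟨u, v⟩
    simp only [Set.mem_iUnion]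
    constructor
    · intro h
      obtain ⟨⟨k, hk⟩, k', hk'⟩ := hT u v h
      exact ⟨k, k', ⟨hk, hk'⟩, ⟨hD k hk, hD' k' hk'⟩, (hWT k k' u hk v hk').1 h⟩
    · rintro ⟨k, k', ⟨hk, hk'⟩, -, h⟩
      exact (hWT k k' u hk v hk').2 h
  rw [key]
  refine Mach.iUnion fun k => Mach.iUnion fun k' => ?_
  exact ((Mach.left (hL k)).inter (Mach.right (hL' k'))).inter
    (Mach.pull N cont cont_length (hW k k'))

theorem reg_Gd [Finite E] (hK : IsRegularSet C.K) (i : I) (lam : Λ) :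
    IsRegularSet {w | Gd C R N i lam w} := by
  have h1 : IsRegularSet {u : List E | pathSrc? C.esrc u = some (R.F i)} := by
    convert reg_head (fun e => C.esrc e = R.F i) using 1
    ext u; exact Option.map_eq_some_iff
  have h2 : IsRegularSet {u : List E | pathTgt? C.etgt u = some (R.G lam)} := by
    convert reg_last (fun e => C.etgt e = R.G lam) using 1
    ext u; exact Option.map_eq_some_iff
  have h3 := reg_inter hK (reg_inter h1 h2)
  have h4 := Mach.pull (α := Ltr E I Λ N) N cont cont_length (Mach.left (β := E) h3)
  have h5 := reg_inter (reg_Sh (C := C) (N := N) i (some lam)) h4.diag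
  convert h5 using 1
  ext w
  constructor
  · rintro ⟨h, h'⟩
    exact ⟨h, ⟨fun l hl => (h.2.2.1 l hl).1, fun l hl => (h.2.2.1 l hl).1⟩, h'⟩
  · rintro ⟨h, -, h'⟩
    exact ⟨h, h'⟩

end


section
variable {O A E I Λ : Type} {S : Sgpd O A} {C : ChoiceOfReps S.toPreSgpd E}
  {R : Rees.Data0 S I Λ} {N : ℕ} {lamP : O → Λ}

/-- The pieces of the language, including the zero. -/
def Pc (C : ChoiceOfReps S.toPreSgpd E) (R : Rees.Data0 S I Λ) (N : ℕ) :
    Option (I × Λ) → Set (List (Ltr E I Λ N))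
  | none => {[none]}
  | some k => {w | Gd C R N k.1 k.2 w}

/-- The pieces of the prefixes of the language. -/
def Pf (C : ChoiceOfReps S.toPreSgpd E) (R : Rees.Data0 S I Λ) (N : ℕ) :
    Option (I × Option Λ) → Set (List (Ltr E I Λ N))
  | none => {[none]}
  | some k => prefs (⋃ k, Pc C R N k) ∩ {w | Sh C N k.1 k.2 w}

theorem reg_zero {α : Type} [Finite α] (a : α) : IsRegularSet ({[a]} : Set (List α)) := by
  have h := reg_inter (reg_inter (reg_head (fun l : α => l = a)) (reg_tail (fun _ : α => False)))
    (reg_last (fun l : α => l = a))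
  convert h using 1
  ext w
  constructor
  · rintro rfl
    exact ⟨⟨⟨a, rfl, rfl⟩, by simp⟩, ⟨a, rfl, rfl⟩⟩
  · rintro ⟨⟨⟨l, h1, rfl⟩, h2⟩, -⟩
    cases w with
    | nil => simp at h1
    | cons b w =>
      simp at h1
      subst h1
      cases w with
      | nil => rfl
      | cons c w => exact (h2 c (by simp)).elim

theorem Pc_reg [Finite E] [Finite I] [Finite Λ] (hK : IsRegularSet C.K) (k : Option (I × Λ)) :
    IsRegularSet (Pc C R N k) := by
  have := finite_ltr (E := E) (I := I) (Λ := Λ) N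
  cases k with
  | none => exact reg_zero _
  | some k => exact reg_Gd hK k.1 k.2

theorem Pf_reg [Finite E] [Finite I] [Finite Λ] (hK : IsRegularSet C.K)
    (k : Option (I × Option Λ)) : IsRegularSet (Pf C R N k) := by
  have := finite_ltr (E := E) (I := I) (Λ := Λ) N
  cases k with
  | none => exact reg_zero _
  | some k => exact reg_inter (reg_prefs (reg_iUnion (Pc_reg hK))) (reg_Sh _ _)

theorem Sh.dr {i : I} {o : Option Λ} {w : List (Ltr E I Λ N)} (h : Sh C N i o w) : w ∈ Dr N :=
  fun l hl => (h.2.2.1 l hl).1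

theorem zero_dr : ([none] : List (Ltr E I Λ N)) ∈ Dr N := by
  intro l hl
  simp at hl

theorem Pc_dr (k : Option (I × Λ)) : Pc C R N k ⊆ Dr N := by
  cases k with
  | none => rintro w rfl; exact zero_dr
  | some k => intro w hw; exact hw.1.dr

theorem Pf_dr (k : Option (I × Option Λ)) : Pf C R N k ⊆ Dr N := by
  cases k with
  | none => rintro w rfl; exact zero_dr
  | some k => intro w hw; exact hw.2.dr

theorem eq_of_pre_zero {α : Type} {v : List α} {a : α} (h : v ≠ []) (h' : v <+: [a]) : v = [a] := by
  cases v with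
  | nil => exact absurd rfl h
  | cons b v =>
    rw [List.cons_prefix_cons] at h'
    obtain ⟨rfl, h'⟩ := h'
    rw [List.prefix_nil.1 h']

theorem Pf_cover {v : List (Ltr E I Λ N)} (hv : v ∈ prefs (⋃ k, Pc C R N k)) :
    ∃ k, v ∈ Pf C R N k := by
  obtain ⟨hne, w, hw, hp⟩ := id hv
  obtain ⟨k, hk⟩ := Set.mem_iUnion.1 hw
  cases k with
  | none =>
    obtain rfl : w = [none] := hk
    exact ⟨none, eq_of_pre_zero hne hp⟩
  | some k =>
    obtain ⟨t, rfl⟩ := hp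
    have hs : Sh C N k.1 (some k.2) (v ++ t) := hk.1
    rcases eq_or_ne t [] with rfl | ht
    · rw [List.append_nil] at hs
      exact ⟨some (k.1, some k.2), hv, hs⟩
    · exact ⟨some (k.1, none), hv, (hs.initSeg hne ht).1⟩

theorem Pf_some {v : List (Ltr E I Λ N)} {i : I} {lam : Λ}
    (hv : v ∈ Pf C R N (some (i, some lam))) : Gd C R N i lam v := by
  obtain ⟨⟨hne, w, hw, t, rfl⟩, hs⟩ := hv
  change Sh C N i (some lam) v at hs
  obtain ⟨k, hk⟩ := Set.mem_iUnion.1 hw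
  cases k with
  | none =>
    have hk' : v ++ t = [none] := hk
    exact absurd (eq_of_pre_zero hne ⟨t, hk'⟩) hs.ne_zero
  | some k =>
    obtain ⟨k1, k2⟩ := k
    have hg : Gd C R N k1 k2 (v ++ t) := hk
    rcases eq_or_ne t [] with rfl | ht
    · rw [List.append_nil] at hg
      obtain ⟨rfl, h⟩ := hs.uniq hg.1
      cases h
      exact hg
    · have := (hs.uniq (hg.1.initSeg hne ht).1).2
      cases this

theorem Pf_none (hN : 1 ≤ N) (hG : ∀ v, R.G (lamP v) = v)
    {lab : Ltr E I Λ N → Rees.Carrier0 S R}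
    (hlab : ∀ l, LabSpec C R N lamP l (lab l)) {v : List (Ltr E I Λ N)} {i : I}
    (hv : v ∈ Pf C R N (some (i, none))) :
    v.flatMap cont ∈ prefs C.K ∧
    ∃ x, ∃ hv : Rees.Valid S R.F R.G (i, x, lamP (S.tgt x)),
      Ev C (v.flatMap cont) x ∧ evalPath? (Rees.pre0 S R) lab v = some (some ⟨_, hv⟩) := by
  obtain ⟨⟨hne, w, hw, t, rfl⟩, hs⟩ := hv
  change Sh C N i none v at hs
  obtain ⟨k, hk⟩ := Set.mem_iUnion.1 hw
  cases k with
  | none =>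
    have hk' : v ++ t = [none] := hk
    exact absurd (eq_of_pre_zero hne ⟨t, hk'⟩) hs.ne_zero
  | some k =>
    obtain ⟨k1, k2⟩ := k
    have hg : Gd C R N k1 k2 (v ++ t) := hk
    rcases eq_or_ne t [] with rfl | ht
    · rw [List.append_nil] at hg
      have := (hs.uniq hg.1).2
      cases this
    · obtain ⟨h1, h2, h3, -⟩ := hg.1.initSeg hne ht
      obtain ⟨rfl, -⟩ := hs.uniq h1
      obtain ⟨-, g2, g3, -⟩ := hg
      rw [List.flatMap_append] at g2 g3
      have hcn := content_ne hne hN h2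
      refine ⟨⟨hcn, _, g2, ⟨_, rfl⟩⟩, ?_⟩
      obtain ⟨c1, -⟩ := chain_append.1 (C.K_path _ g2).2
      obtain ⟨x, hx⟩ := Ev.exists hcn c1
      have hsrc : R.F i = S.src x := by
        have := hx.ends.1
        rw [pathSrc?, List.head?_append_of_ne_nil _ hcn] at g3
        rw [pathSrc?, g3] at this
        exact Option.some.inj this
      have hvl : Rees.Valid S R.F R.G (i, x, lamP (S.tgt x)) := ⟨hsrc, (hG _).symm⟩
      exact ⟨x, hvl, hx, value hN hG hlab hs hx hvl⟩

theorem triple_eq {i i' : I} {x x' : A} {lam lam' : Λ} {hv : Rees.Valid S R.F R.G (i, x, lam)}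
    {hv' : Rees.Valid S R.F R.G (i', x', lam')} :
    (some (some ⟨_, hv⟩) : Option (Rees.Carrier0 S R)) = some (some ⟨_, hv'⟩) ↔
      i = i' ∧ x = x' ∧ lam = lam' := by
  constructor
  · intro h
    have := congrArg Subtype.val (Option.some.inj (Option.some.inj h))
    simpa using this
  · rintro ⟨rfl, rfl, rfl⟩
    rfl

theorem some_ne_zero {t : Rees.Triples S R.F R.G} :
    (some (some t) : Option (Rees.Carrier0 S R)) ≠ some none := by
  intro h
  have h' : (some t : Option (Rees.Triples S R.F R.G)) = none := Option.some.inj h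
  cases h'

theorem mul0_none_left (b : Rees.Carrier0 S R) : Rees.mul0 S R none b = none := by
  cases b <;> rfl

theorem mul0_none_right (b : Rees.Carrier0 S R) : Rees.mul0 S R b none = none := by
  cases b <;> rfl

theorem unit_chain {α : Type} (w : List α) :
    IsPathChain (fun _ : α => ()) (fun _ => ()) w := by
  induction w with
  | nil => exact List.isChain_nil
  | cons a w ih => exact List.isChain_cons.2 ⟨fun _ _ => rfl, ih⟩

theorem Pc_val (hN : 1 ≤ N) (hG : ∀ v, R.G (lamP v) = v)
    {lab : Ltr E I Λ N → Rees.Carrier0 S R}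
    (hlab : ∀ l, LabSpec C R N lamP l (lab l)) (k : Option (I × Λ)) {w : List (Ltr E I Λ N)}
    (h : w ∈ Pc C R N k) :
    (k = none ∧ evalPath? (Rees.pre0 S R) lab w = some none) ∨
    ∃ i lam, k = some (i, lam) ∧ Gd C R N i lam w ∧
      ∃ x, ∃ hv : Rees.Valid S R.F R.G (i, x, lam),
      Ev C (w.flatMap cont) x ∧ evalPath? (Rees.pre0 S R) lab w = some (some ⟨_, hv⟩) := by
  cases k with
  | none =>
    obtain rfl : w = [none] := h
    exact Or.inl ⟨rfl, congrArg some ((hlab none).1 rfl)⟩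
  | some k => exact Or.inr ⟨k.1, k.2, rfl, h, Gd.value hN hG hlab h⟩

theorem mach_val [Finite E] [Finite I] [Finite Λ] (hN : 1 ≤ N) (hG : ∀ v, R.G (lamP v) = v)
    {lab : Ltr E I Λ N → Rees.Carrier0 S R}
    (hlab : ∀ l, LabSpec C R N lamP l (lab l)) (hK : IsRegularSet C.K)
    (f : Rees.Carrier0 S R → Rees.Carrier0 S R) (h0 : f none = none)
    (hf : ∀ i lam, (∀ x hv, f (some ⟨(i, x, lam), hv⟩) = none) ∨
      ∃ mu, ∃ s : Option A, (∀ z, s = some z → Mach (relS C z)) ∧ (s = none → Mach (relEq C)) ∧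
        ∀ x hv, ∃ hv', (∀ z, s = some z → S.tgt x = S.src z) ∧
          f (some ⟨(i, x, lam), hv⟩) = some ⟨(i, s.elim x (S.mul x), mu), hv'⟩) :
    Mach {p : List (Ltr E I Λ N) × List (Ltr E I Λ N) |
      p.1 ∈ (⋃ k, Pc C R N k) ∧ p.2 ∈ (⋃ k, Pc C R N k) ∧
      ∃ a, evalPath? (Rees.pre0 S R) lab p.1 = some a ∧
        evalPath? (Rees.pre0 S R) lab p.2 = some (f a)} := by
  refine mach_pieces (Pc_reg hK) (Pc_reg hK) Pc_dr Pc_dr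
    (fun u v h => ⟨Set.mem_iUnion.1 h.1, Set.mem_iUnion.1 h.2.1⟩) fun k k' => ?_
  have hmem : ∀ k {u}, u ∈ Pc C R N k → u ∈ (⋃ k, Pc C R N k) :=
    fun k u hu => Set.mem_iUnion.2 ⟨k, hu⟩
  have zcase : (∀ u ∈ Pc C R N k, ∃ a, evalPath? (Rees.pre0 S R) lab u = some a ∧ f a = none) →
      ∃ W : Set (List E × List E), Mach W ∧ ∀ u ∈ Pc C R N k, ∀ v ∈ Pc C R N k',
      ((u, v) ∈ {p : List (Ltr E I Λ N) × List (Ltr E I Λ N) |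
      p.1 ∈ (⋃ k, Pc C R N k) ∧ p.2 ∈ (⋃ k, Pc C R N k) ∧
      ∃ a, evalPath? (Rees.pre0 S R) lab p.1 = some a ∧
        evalPath? (Rees.pre0 S R) lab p.2 = some (f a)} ↔
        (u.flatMap cont, v.flatMap cont) ∈ W) := by
    intro hz
    refine ⟨_, Mach.const (k' = none), fun u hu v hv => ?_⟩
    obtain ⟨a, ha, ha'⟩ := hz u hu
    constructor
    · rintro ⟨-, -, b, hb, hb'⟩
      rw [ha] at hb
      cases hb
      change evalPath? (Rees.pre0 S R) lab v = _ at hb'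
      rw [ha'] at hb'
      rcases Pc_val hN hG hlab k' hv with ⟨h, -⟩ | ⟨i, lam, -, -, x, hx, -, h⟩
      · exact h
      · rw [hb'] at h
        exact absurd h.symm some_ne_zero
    · intro h
      refine ⟨hmem _ hu, hmem _ hv, a, ha, ?_⟩
      rcases Pc_val hN hG hlab k' hv with ⟨-, h'⟩ | ⟨i, lam, h', -⟩
      · rw [ha']; exact h'
      · have : k' = none := h
        rw [this] at h'; cases h'
  match k with
  | none =>
    refine zcase fun u hu => ?_
    obtain rfl : u = [none] := hu
    exact ⟨none, congrArg some ((hlab none).1 rfl), h0⟩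
  | some (i, lam) =>
    rcases hf i lam with hf | ⟨mu, s, hs1, hs2, hf⟩
    · refine zcase fun u hu => ?_
      obtain ⟨x, hv, -, h⟩ := Gd.value hN hG hlab hu
      exact ⟨_, h, hf x hv⟩
    · by_cases hk : k' = some (i, mu)
      · subst hk
        refine ⟨s.elim (relEq C) (relS C), ?_, ?_⟩
        · cases s with
          | none => exact hs2 rfl
          | some z => exact hs1 z rfl
        · intro u hu v hv
          obtain ⟨x, hvx, hx, h⟩ := Gd.value hN hG hlab hu
          obtain ⟨y, hvy, hy, h'⟩ := Gd.value hN hG hlab hv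
          obtain ⟨hvf, hc, hfx⟩ := hf x hvx
          have e1 : (u, v) ∈ {p : List (Ltr E I Λ N) × List (Ltr E I Λ N) |
              p.1 ∈ (⋃ k, Pc C R N k) ∧ p.2 ∈ (⋃ k, Pc C R N k) ∧
              ∃ a, evalPath? (Rees.pre0 S R) lab p.1 = some a ∧
              evalPath? (Rees.pre0 S R) lab p.2 = some (f a)} ↔ y = s.elim x (S.mul x) := by
            constructor
            · rintro ⟨-, -, a, h1, h2⟩
              change evalPath? (Rees.pre0 S R) lab u = _ at h1
              change evalPath? (Rees.pre0 S R) lab v = _ at h2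
              rw [h] at h1
              cases h1
              rw [h', hfx] at h2
              exact (triple_eq.1 h2).2.1
            · intro h1
              refine ⟨hmem _ hu, hmem _ hv, _, h, ?_⟩
              change evalPath? (Rees.pre0 S R) lab v = _
              rw [h', hfx]
              exact triple_eq.2 ⟨rfl, h1, rfl⟩
          rw [e1]
          cases s with
          | none =>
            constructor
            · intro h1
              change y = x at h1
              subst h1
              exact ⟨hu.2.1, hv.2.1, hx.2.2.trans hy.2.2.symm⟩
            · rintro ⟨-, -, h1⟩
              change evalPath? S.toPreSgpd C.lab (u.flatMap cont) =
                evalPath? S.toPreSgpd C.lab (v.flatMap cont) at h1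
              rw [hx.2.2, hy.2.2] at h1
              exact (Option.some.inj h1).symm
          | some z =>
            constructor
            · intro h1
              change y = S.mul x z at h1
              subst h1
              exact ⟨hu.2.1, hv.2.1, x, hx, hc z rfl, hy⟩
            · rintro ⟨-, -, x', h1, h2, h3⟩
              have := hx.unique h1
              subst this
              exact hy.unique h3
      · refine ⟨_, Mach.const False, fun u hu v hv => ?_⟩
        constructor
        · rintro ⟨-, -, a, h1, h2⟩
          change evalPath? (Rees.pre0 S R) lab u = _ at h1
          change evalPath? (Rees.pre0 S R) lab v = _ at h2
          obtain ⟨x, hvx, hx, h⟩ := Gd.value hN hG hlab hu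
          rw [h] at h1
          cases h1
          obtain ⟨hvf, hc, hfx⟩ := hf x hvx
          rw [hfx] at h2
          rcases Pc_val hN hG hlab k' hv with ⟨-, h3⟩ | ⟨i', lam', rfl, -, y, hy, -, h3⟩
          · rw [h3] at h2
            exact absurd h2.symm some_ne_zero
          · rw [h3] at h2
            obtain ⟨rfl, -, rfl⟩ := triple_eq.1 h2
            exact absurd rfl hk
        · intro h; exact False.elim h

theorem mach_pref [Finite E] [Finite I] [Finite Λ] (hN : 1 ≤ N) (hG : ∀ v, R.G (lamP v) = v)
    {lab : Ltr E I Λ N → Rees.Carrier0 S R}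
    (hlab : ∀ l, LabSpec C R N lamP l (lab l)) (hK : IsRegularSet C.K)
    (hE : Mach (relEq C)) (hP : Mach (relPrefEq C)) :
    Mach {p : List (Ltr E I Λ N) × List (Ltr E I Λ N) |
      p.1 ∈ (⋃ k, Pc C R N k) ∧ p.2 ∈ prefs (⋃ k, Pc C R N k) ∧
      evalPath? (Rees.pre0 S R) lab p.1 = evalPath? (Rees.pre0 S R) lab p.2} := by
  refine mach_pieces (Pc_reg hK) (Pf_reg hK) Pc_dr Pf_dr
    (fun u v h => ⟨Set.mem_iUnion.1 h.1, Pf_cover h.2.1⟩) fun k k' => ?_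
  have hmem : ∀ k {u}, u ∈ Pc C R N k → u ∈ (⋃ k, Pc C R N k) :=
    fun k u hu => Set.mem_iUnion.2 ⟨k, hu⟩
  have hmem' : ∀ k {u}, u ∈ Pf C R N k → u ∈ prefs (⋃ k, Pc C R N k) := by
    intro k u hu
    cases k with
    | none =>
      obtain rfl : u = [none] := hu
      exact ⟨by simp, [none], hmem none rfl, List.prefix_rfl⟩
    | some k => exact hu.1
  have red : (∃ W : Set (List E × List E), Mach W ∧ ∀ u ∈ Pc C R N k, ∀ v ∈ Pf C R N k',
      (evalPath? (Rees.pre0 S R) lab u = evalPath? (Rees.pre0 S R) lab v ↔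
        (u.flatMap cont, v.flatMap cont) ∈ W)) → ∃ W : Set (List E × List E), Mach W ∧
      ∀ u ∈ Pc C R N k, ∀ v ∈ Pf C R N k',
      ((u, v) ∈ {p : List (Ltr E I Λ N) × List (Ltr E I Λ N) |
      p.1 ∈ (⋃ k, Pc C R N k) ∧ p.2 ∈ prefs (⋃ k, Pc C R N k) ∧
      evalPath? (Rees.pre0 S R) lab p.1 = evalPath? (Rees.pre0 S R) lab p.2} ↔
        (u.flatMap cont, v.flatMap cont) ∈ W) := by
    rintro ⟨W, hW, h⟩
    refine ⟨W, hW, fun u hu v hv => ?_⟩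
    rw [← h u hu v hv]
    exact ⟨fun h => h.2.2, fun h => ⟨hmem k hu, hmem' k' hv, h⟩⟩
  apply red
  have hz : evalPath? (Rees.pre0 S R) lab [none] = some none :=
    congrArg some ((hlab none).1 rfl)
  match k, k' with
  | none, none =>
    refine ⟨_, Mach.const True, fun u hu v hv => ?_⟩
    obtain rfl : u = [none] := hu
    obtain rfl : v = [none] := hv
    exact ⟨fun _ => trivial, fun _ => rfl⟩
  | none, some (i', some lam') =>
    refine ⟨_, Mach.const False, fun u hu v hv => ?_⟩
    obtain rfl : u = [none] := hu
    obtain ⟨x, hvx, hx, h⟩ := Gd.value hN hG hlab (Pf_some hv)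
    rw [hz, h]
    exact ⟨fun h => absurd h.symm some_ne_zero, fun h => False.elim h⟩
  | none, some (i', none) =>
    refine ⟨_, Mach.const False, fun u hu v hv => ?_⟩
    obtain rfl : u = [none] := hu
    obtain ⟨-, x, hvx, hx, h⟩ := Pf_none hN hG hlab hv
    rw [hz, h]
    exact ⟨fun h => absurd h.symm some_ne_zero, fun h => False.elim h⟩
  | some (i, lam), none =>
    refine ⟨_, Mach.const False, fun u hu v hv => ?_⟩
    obtain rfl : v = [none] := hv
    obtain ⟨x, hvx, hx, h⟩ := Gd.value (i := i) (lam := lam) hN hG hlab hu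
    rw [hz, h]
    exact ⟨fun h => absurd h some_ne_zero, fun h => False.elim h⟩
  | some (i, lam), some (i', some lam') =>
    by_cases hk : i = i' ∧ lam = lam'
    · obtain ⟨rfl, rfl⟩ := hk
      refine ⟨_, hE, fun u hu v hv => ?_⟩
      have hv := Pf_some hv
      obtain ⟨x, hvx, hx, h⟩ := Gd.value (i := i) (lam := lam) hN hG hlab hu
      obtain ⟨y, hvy, hy, h'⟩ := Gd.value hN hG hlab hv
      rw [h, h']; refine triple_eq.trans ?_
      constructor
      · rintro ⟨-, rfl, -⟩
        exact ⟨hu.2.1, hv.2.1, hx.2.2.trans hy.2.2.symm⟩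
      · rintro ⟨-, -, h1⟩
        have h2 := hx.2.2.symm.trans (h1.trans hy.2.2)
        exact ⟨rfl, Option.some.inj h2, rfl⟩
    · refine ⟨_, Mach.const False, fun u hu v hv => ?_⟩
      have hv := Pf_some hv
      obtain ⟨x, hvx, hx, h⟩ := Gd.value (i := i) (lam := lam) hN hG hlab hu
      obtain ⟨y, hvy, hy, h'⟩ := Gd.value hN hG hlab hv
      rw [h, h']; refine triple_eq.trans ?_
      exact ⟨fun h => hk ⟨h.1, h.2.2⟩, fun h => False.elim h⟩
  | some (i, lam), some (i', none) =>
    by_cases hk : i = i' ∧ lam = lamP (R.G lam)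
    · obtain ⟨rfl, hk⟩ := hk
      refine ⟨_, hP, fun u hu v hv => ?_⟩
      obtain ⟨x, hvx, hx, h⟩ := Gd.value (i := i) (lam := lam) hN hG hlab hu
      obtain ⟨hpf, y, hvy, hy, h'⟩ := Pf_none hN hG hlab hv
      rw [h, h']; refine triple_eq.trans ?_
      constructor
      · rintro ⟨-, rfl, -⟩
        exact ⟨hu.2.1, hpf, hx.2.2.trans hy.2.2.symm⟩
      · rintro ⟨-, -, h1⟩
        have h2 := Option.some.inj (hx.2.2.symm.trans (h1.trans hy.2.2))
        subst h2
        refine ⟨rfl, rfl, ?_⟩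
        have h3 : S.tgt x = R.G lam := hvx.2
        rw [h3]; exact hk
    · refine ⟨_, Mach.const False, fun u hu v hv => ?_⟩
      obtain ⟨x, hvx, hx, h⟩ := Gd.value (i := i) (lam := lam) hN hG hlab hu
      obtain ⟨hpf, y, hvy, hy, h'⟩ := Pf_none hN hG hlab hv
      rw [h, h']; refine triple_eq.trans ?_
      refine ⟨?_, fun h => False.elim h⟩
      rintro ⟨h1, h2, h3⟩
      subst h2
      have h4 : S.tgt x = R.G lam := hvx.2
      rw [h4] at h3
      exact hk ⟨h1, h3⟩

end

/-- Theorem 5.1: a finitely generated Rees matrix semigroup with zero over a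
prefix-automatic small category, whose non-identity arrows are strongly
right-ideal-generated by a row cross-section of `P`, is prefix-automatic. -/
theorem stmt_12 {O A I Λ : Type} (S : Sgpd O A) (hne : Nonempty A)
    (hiso : IsolationFree S.toPreSgpd) (hcat : IsSmallCategory S.toPreSgpd)
    (R : Rees.Data0 S I Λ)
    (hfg : IsFG (Rees.pre0 S R))
    (hS : IsPrefixAutomatic S.toPreSgpd)
    (hrig : Rees.StronglyRIG0 S R { a : A | ¬ IsIdentity S.toPreSgpd a }) :
    IsPrefixAutomatic (Rees.pre0 S R) := by
  obtain ⟨E, C, ⟨hE, hK, hedge, hvert⟩, hpref⟩ := hS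
  obtain ⟨hI, hΛ⟩ := Rees.finite_I hfg
  have hO : Finite O := finite_obj hcat C
  obtain ⟨N, hN, hpump⟩ := pump (C := C) hcat hK
  obtain ⟨Λ', hbij, hgen⟩ := hrig
  have hex : ∀ v : O, ∃ lam ∈ Λ', R.G lam = v := by
    intro v
    obtain ⟨e, -, h2, -⟩ := hcat v
    exact hbij.surjOn ⟨e, h2⟩
  choose lamP hlamP hG using hex
  have hr : ∀ x, ¬ IsIdentity S.toPreSgpd x → Gen R lamP x := by
    intro x hx
    obtain ⟨lam, hlam, j, p, s, h1, h2, h3⟩ := hgen x hx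
    have h4 : lamP (S.src x) = lam := by
      refine hbij.injOn (hlamP _) hlam ?_
      rw [hG, h3, S.src_mul _ _ h2, R.P_src _ _ _ h1]
    exact ⟨j, p, s, by rw [h4]; exact h1, h2, h3⟩
  choose lab hlab using labSpec_exists (C := C) (R := R) (N := N) (lamP := lamP) hr
  have hLtr := finite_ltr (E := E) (I := I) (Λ := Λ) N
  have hEq : Mach (relEq C) := relEq_mach hvert
  have hPr : Mach (relPrefEq C) := mach_of_sync _ hpref
  have hone : ∀ w ∈ (⋃ k, Pc C R N k), w ≠ [] := by
    intro w hw
    obtain ⟨k, hk⟩ := Set.mem_iUnion.1 hw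
    cases k with
    | none =>
      obtain rfl : w = [none] := hk
      simp
    | some k => exact hk.1.ne
  let C' : ChoiceOfReps (Rees.pre0 S R) (Ltr E I Λ N) :=
    { esrc := fun _ => ()
      etgt := fun _ => ()
      lab := lab
      lab_src := fun _ => rfl
      lab_tgt := fun _ => rfl
      K := ⋃ k, Pc C R N k
      K_path := by
        intro w hw
        refine ⟨hone w hw, ?_⟩
        exact unit_chain w
      K_onto := by
        intro m
        match m with
        | none => exact ⟨[none], Set.mem_iUnion.2 ⟨none, rfl⟩, congrArg some ((hlab none).1 rfl)⟩
        | some ⟨(i, x, lam), hv⟩ =>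
          obtain ⟨u, hu, hx, h⟩ := hpump x
          obtain ⟨w, hw, hwu⟩ := chunk (C := C) hN i lam u h
          have hg : Gd C R N i lam w := by
            subst hwu
            exact ⟨hw, hu, by rw [hx.ends.1]; exact congrArg some hv.1.symm,
              by rw [hx.ends.2]; exact congrArg some hv.2⟩
          refine ⟨w, Set.mem_iUnion.2 ⟨some (i, lam), hg⟩, ?_⟩
          obtain ⟨y, hvy, hy, h'⟩ := Gd.value hN hG hlab hg
          rw [hwu] at hy
          obtain rfl := hx.unique hy
          exact h' }
  have hval : ∀ w ∈ C'.K, ∃ a, evalPath? (Rees.pre0 S R) lab w = some a := by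
    intro w hw
    cases w with
    | nil => exact absurd rfl (hone _ hw)
    | cons a w => exact ⟨_, rfl⟩
  have htgt : ∀ w ∈ C'.K, pathTgt? C'.etgt w = some () := by
    intro w hw
    rw [pathTgt?, List.getLast?_eq_some_getLast (hone w hw)]
    rfl
  refine ⟨_, C', ⟨hLtr, reg_iUnion (Pc_reg hK), ?_, ?_⟩, ?_⟩
  · intro a
    apply sync_of_mach
    have key : relEdge C' a = {p : List (Ltr E I Λ N) × List (Ltr E I Λ N) |
      p.1 ∈ (⋃ k, Pc C R N k) ∧ p.2 ∈ (⋃ k, Pc C R N k) ∧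
      ∃ m, evalPath? (Rees.pre0 S R) lab p.1 = some m ∧
        evalPath? (Rees.pre0 S R) lab p.2 = some (Rees.mul0 S R m (lab a))} := by
      ext ⟨u, v⟩
      constructor
      · rintro ⟨h1, h2, -, h4⟩
        obtain ⟨m, hm⟩ := hval u h1
        refine ⟨h1, h2, m, hm, ?_⟩
        exact h4.symm.trans (eval_snoc _ _ a hm)
      · rintro ⟨h1, h2, m, hm, h4⟩
        exact ⟨h1, h2, htgt u h1, (eval_snoc _ _ a hm).trans h4.symm⟩
    rw [key]
    refine mach_val hN hG hlab hK (fun m => Rees.mul0 S R m (lab a)) (mul0_none_left _) ?_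
    intro i lam
    generalize lab a = b
    match b with
    | none => exact Or.inl fun x hv => mul0_none_right _
    | some ⟨(j, y, mu), hy⟩ =>
      rcases hp : R.P lam j with _ | p
      · exact Or.inl fun x hv => Rees.mul0_zero hv hy hp
      · have hpy : S.tgt p = S.src y := (R.P_tgt _ _ _ hp).trans hy.1
        refine Or.inr ⟨mu, some (S.mul p y), fun z _ => relS_mach hedge z, fun h => (by cases h), ?_⟩
        intro x hv
        obtain ⟨hv', h⟩ := Rees.mul0_some hv hy hp
        have hxp : S.tgt x = S.src p := hv.2.trans (R.P_src _ _ _ hp).symm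
        have he : S.mul (S.mul x p) y = S.mul x (S.mul p y) := S.mul_assoc' _ _ _ hxp hpy
        refine ⟨?_, ?_, ?_⟩
        · show Rees.Valid S R.F R.G (i, S.mul x (S.mul p y), mu)
          rw [← he]; exact hv'
        · intro z hz
          cases hz
          rw [S.src_mul _ _ hpy]; exact hxp
        · refine h.trans ?_
          exact Option.some.inj (triple_eq.2 ⟨rfl, he, rfl⟩)
  · intro o
    apply sync_of_mach
    have key : relVertex C' o = {p : List (Ltr E I Λ N) × List (Ltr E I Λ N) |
      p.1 ∈ (⋃ k, Pc C R N k) ∧ p.2 ∈ (⋃ k, Pc C R N k) ∧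
      ∃ m, evalPath? (Rees.pre0 S R) lab p.1 = some m ∧
        evalPath? (Rees.pre0 S R) lab p.2 = some (id m)} := by
      ext ⟨u, v⟩
      constructor
      · rintro ⟨h1, h2, -, h4⟩
        obtain ⟨m, hm⟩ := hval u h1
        exact ⟨h1, h2, m, hm, h4.symm.trans hm⟩
      · rintro ⟨h1, h2, m, hm, h4⟩
        exact ⟨h1, h2, htgt u h1, hm.trans h4.symm⟩
    rw [key]
    refine mach_val hN hG hlab hK id rfl ?_
    intro i lam
    refine Or.inr ⟨lam, none, fun z h => (by cases h), fun _ => hEq, fun x hv => ⟨hv, ?_, rfl⟩⟩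
    intro z h
    cases h
  · apply sync_of_mach
    exact mach_pref hN hG hlab hK hEq hPr

end AutoRees
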